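/- arXiv:2103.02468 — 3 statements merged into one kernel-verified Lean document; each statement's English description precedes it below -/
import Mathlib

section
/- There is a universal constant K > 0 such that the following holds. Let 𝒮 = (|ψ⟩, A, B) be a strategy with question sets 𝒳, 𝒴 and answer sets 𝒜, ℬ, let {Â^x_a} be a family of POVMs on H_A, and let 𝒮̂ = (|ψ⟩, Â, B). Let ρ_A be the reduced density of |ψ⟩ on H_A and |ψ_A⟩ ∈ H_A ⊗ H_A its canonical purification, and let 𝒮_A = (|ψ_A⟩, A, A^T) (transposes in the eigenbasis defining |ψ_A⟩). Let ν be a distribution on 𝒳 × 𝒴 with marginal ν_A on 𝒳, let δ = δ_sync(𝒮_A; ν_A), and let γ = E_{x∼ν_A} Σ_a Tr((A^x_a − Â^x_a)² ρ_A). Let C and Ĉ be the correlations induced by 𝒮 and 𝒮̂ respectively. Then E_{(x,y)∼ν} Σ_{a,b} |C_{x,y,a,b} − Ĉ_{x,y,a,b}| ≤ K(δ + √γ). -/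
open scoped Kronecker ComplexOrder
open Matrix MeasureTheory

attribute [local instance] Matrix.normedAddCommGroup Matrix.normedSpace

namespace AlmostSync

/-- Frobenius norm of a complex matrix. -/
noncomputable def frob {n : Type*} [Fintype n] (X : Matrix n n ℂ) : ℝ :=
  Real.sqrt ((Xᴴ * X).trace.re)

/-- `⟨ψ| M |ψ⟩` (real part). -/
noncomputable def ev {m : Type*} [Fintype m] (ψ : m → ℂ) (M : Matrix m m ℂ) : ℝ :=
  (star ψ ⬝ᵥ M.mulVec ψ).re

/-- Squared `ℓ²` norm of a vector. -/
noncomputable def nsq {m : Type*} [Fintype m] (v : m → ℂ) : ℝ :=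
  ∑ p, Complex.normSq (v p)

/-- A probability distribution on a finite set. -/
def IsDist {𝒳 : Type*} [Fintype 𝒳] (ν : 𝒳 → ℝ) : Prop :=
  (∀ x, 0 ≤ ν x) ∧ ∑ x, ν x = 1

/-- A POVM on a finite-dimensional space. -/
def IsPOVM {n 𝒜 : Type*} [Fintype n] [DecidableEq n] [Fintype 𝒜]
    (A : 𝒜 → Matrix n n ℂ) : Prop :=
  (∀ a, (A a).PosSemidef) ∧ ∑ a, A a = 1

/-- A projective measurement. -/
def IsProjMeas {n 𝒜 : Type*} [Fintype n] [DecidableEq n] [Fintype 𝒜]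
    (A : 𝒜 → Matrix n n ℂ) : Prop :=
  (∀ a, (A a)ᴴ = A a ∧ A a * A a = A a) ∧ ∑ a, A a = 1

/-- A projective measurement supported on the range of a projection `P`. -/
def IsProjMeasOn {n 𝒜 : Type*} [Fintype n] [DecidableEq n] [Fintype 𝒜]
    (P : Matrix n n ℂ) (A : 𝒜 → Matrix n n ℂ) : Prop :=
  (∀ a, (A a)ᴴ = A a ∧ A a * A a = A a ∧ P * A a = A a ∧ A a * P = A a) ∧ ∑ a, A a = P

/-- The state `Σ_i √(lam i) |i⟩|i⟩` (standard basis as eigenbasis). -/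
noncomputable def canonPsi {n : Type*} [DecidableEq n] (lam : n → ℝ) : n × n → ℂ :=
  fun p => if p.1 = p.2 then (Real.sqrt (lam p.1) : ℂ) else 0

/-- The maximally entangled state `d^{-1/2} Σ_i |i⟩|i⟩`. -/
noncomputable def mePsi (d : ℕ) : Fin d × Fin d → ℂ :=
  fun p => if p.1 = p.2 then ((Real.sqrt d)⁻¹ : ℂ) else 0

/-- Default to synchronicity `E_{x∼ν} Σ_{a≠b} ⟨ψ| A^x_a ⊗ B^x_b |ψ⟩`. -/
noncomputable def deltaSync {n₁ n₂ 𝒳 𝒜 : Type*} [Fintype n₁] [Fintype n₂]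
    [Fintype 𝒳] [Fintype 𝒜] [DecidableEq 𝒜]
    (ν : 𝒳 → ℝ) (ψ : n₁ × n₂ → ℂ)
    (A : 𝒳 → 𝒜 → Matrix n₁ n₁ ℂ) (B : 𝒳 → 𝒜 → Matrix n₂ n₂ ℂ) : ℝ :=
  ∑ x, ν x * ∑ a, ∑ b, if a = b then 0 else ev ψ (A x a ⊗ₖ B x b)

/-- The correlation induced by a strategy. -/
noncomputable def corr {n₁ n₂ 𝒳 𝒴 𝒜 ℬ : Type*} [Fintype n₁] [Fintype n₂]
    (ψ : n₁ × n₂ → ℂ) (A : 𝒳 → 𝒜 → Matrix n₁ n₁ ℂ) (B : 𝒴 → ℬ → Matrix n₂ n₂ ℂ)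
    (x : 𝒳) (y : 𝒴) (a : 𝒜) (b : ℬ) : ℝ :=
  ev ψ (A x a ⊗ₖ B y b)

/-- Success probability of a strategy in a nonlocal game. -/
noncomputable def winProb {n₁ n₂ 𝒳 𝒴 𝒜 ℬ : Type*} [Fintype n₁] [Fintype n₂]
    [Fintype 𝒳] [Fintype 𝒴] [Fintype 𝒜] [Fintype ℬ]
    (ν : 𝒳 × 𝒴 → ℝ) (D : 𝒳 → 𝒴 → 𝒜 → ℬ → Bool)
    (ψ : n₁ × n₂ → ℂ) (A : 𝒳 → 𝒜 → Matrix n₁ n₁ ℂ) (B : 𝒴 → ℬ → Matrix n₂ n₂ ℂ) : ℝ :=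
  ∑ x, ∑ y, ν (x, y) * ∑ a, ∑ b, (if D x y a b then (1:ℝ) else 0) * ev ψ (A x a ⊗ₖ B y b)

/-- Reduced density operator on the first tensor factor. -/
noncomputable def rhoA {n₁ n₂ : Type*} [Fintype n₂] (ψ : n₁ × n₂ → ℂ) : Matrix n₁ n₁ ℂ :=
  Matrix.of fun i i' => ∑ j, ψ (i, j) * star (ψ (i', j))

/-- Reduced density operator on the second tensor factor. -/
noncomputable def rhoB {n₁ n₂ : Type*} [Fintype n₁] (ψ : n₁ × n₂ → ℂ) : Matrix n₂ n₂ ℂ :=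
  Matrix.of fun j j' => ∑ i, ψ (i, j) * star (ψ (i, j'))

/-- Transpose with respect to the orthonormal basis given by the columns of a unitary `U`. -/
noncomputable def transposeB {n : Type*} [Fintype n] (U X : Matrix n n ℂ) : Matrix n n ℂ :=
  U * (Uᴴ * X * U)ᵀ * Uᴴ

/-- Canonical purification `Σ_k √(lam k) |u_k⟩|u_k⟩` of `U * diagonal lam * Uᴴ`,
where `u_k` is the `k`-th column of `U`. -/
noncomputable def purif {n : Type*} [Fintype n] (U : Matrix n n ℂ) (lam : n → ℝ) :
    n × n → ℂ :=
  fun p => ∑ k, (Real.sqrt (lam k) : ℂ) * U p.1 k * U p.2 k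

/-- Spectral projection of a Hermitian matrix onto eigenvalues `≥ t`
(the indicator of `[t, ∞)` applied via the functional calculus). -/
noncomputable def specProj {n : Type*} [Fintype n] [DecidableEq n] {M : Matrix n n ℂ}
    (hM : M.IsHermitian) (t : ℝ) : Matrix n n ℂ :=
  hM.cfc (fun x => if t ≤ x then 1 else 0)

/-- Spectral projection at level `t` of the diagonal matrix with entries `lam`. -/
noncomputable def Pdiag {n : Type*} [Fintype n] [DecidableEq n] (lam : n → ℝ) (t : ℝ) :
    Matrix n n ℂ :=
  Matrix.diagonal (fun i => if t ≤ lam i then 1 else 0)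

/-- `ψ` is the maximally entangled state on `H' ⊗ H'` where `H'` is the range of the
projection `P`. -/
def IsMaxEntOn {n : Type*} [Fintype n] [DecidableEq n] (ψ : n × n → ℂ)
    (P : Matrix n n ℂ) : Prop :=
  ∃ (S : Finset n) (v : n → n → ℂ),
    (∀ i ∈ S, ∀ j ∈ S, star (v i) ⬝ᵥ v j = if i = j then 1 else 0) ∧
    P = ∑ i ∈ S, Matrix.vecMulVec (v i) (star (v i)) ∧
    ψ = fun p => ((Real.sqrt S.card)⁻¹ : ℂ) * ∑ i ∈ S, v i p.1 * v i p.2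

lemma rhoA_isHermitian {n₁ n₂ : Type*} [Fintype n₂] (ψ : n₁ × n₂ → ℂ) :
    (rhoA ψ).IsHermitian := by
  refine Matrix.ext fun i j => ?_
  simp only [rhoA, Matrix.conjTranspose_apply, Matrix.of_apply, star_sum, star_mul',
    star_star]
  exact Finset.sum_congr rfl fun k _ => mul_comm _ _

lemma rhoB_isHermitian {n₁ n₂ : Type*} [Fintype n₁] (ψ : n₁ × n₂ → ℂ) :
    (rhoB ψ).IsHermitian := by
  refine Matrix.ext fun i j => ?_
  simp only [rhoB, Matrix.conjTranspose_apply, Matrix.of_apply, star_sum, star_mul',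
    star_star]
  exact Finset.sum_congr rfl fun k _ => mul_comm _ _


/-- A positive real-linear functional satisfies the symmetrized Cauchy–Schwarz inequality. -/
lemma abs_map_mul_add_mul_le {n : Type*} [Fintype n] (φ : Matrix n n ℂ →ₗ[ℝ] ℝ)
    (hφ : ∀ M : Matrix n n ℂ, M.PosSemidef → 0 ≤ φ M) {X Y : Matrix n n ℂ}
    (hX : X.IsHermitian) (hY : Y.IsHermitian) :
    |φ (X * Y + Y * X)| ≤ 2 * (√(φ (X * X)) * √(φ (Y * Y))) := by
  have hsq : ∀ Z : Matrix n n ℂ, Z.IsHermitian → 0 ≤ φ (Z * Z) := fun Z hZ => by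
    have h := hφ _ (Matrix.posSemidef_conjTranspose_mul_self Z)
    rwa [hZ.eq] at h
  have hquad : ∀ t : ℝ,
      0 ≤ φ (X * X) * (t * t) + φ (X * Y + Y * X) * t + φ (Y * Y) := fun t => by
    have hZ : (t • X + Y).IsHermitian := (hX.smul (by simp [IsSelfAdjoint])).add hY
    have h := hsq _ hZ
    have e : (t • X + Y) * (t • X + Y)
        = (t * t) • (X * X) + t • (X * Y + Y * X) + Y * Y := by
      simp only [mul_add, add_mul, smul_mul_assoc, mul_smul_comm, smul_smul, smul_add]
      abel
    rw [e] at h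
    simp only [map_add, map_smul, smul_eq_mul] at h ⊢
    linarith
  have hd := discrim_le_zero hquad
  rw [discrim] at hd
  refine abs_le_of_sq_le_sq ?_ (by positivity)
  rw [mul_pow, mul_pow, Real.sq_sqrt (hsq X hX), Real.sq_sqrt (hsq Y hY)]
  linarith

lemma IsPOVM.posSemidef_sub_mul_self {n 𝒜 : Type*} [Fintype n] [DecidableEq n] [Fintype 𝒜]
    {A : 𝒜 → Matrix n n ℂ} (hA : IsPOVM A) (a : 𝒜) : (A a - A a * A a).PosSemidef := by
  classical
  have hc : (1 - A a).PosSemidef := by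
    rw [← hA.2, ← Finset.add_sum_erase _ _ (Finset.mem_univ a), add_sub_cancel_left]
    exact Matrix.posSemidef_sum _ fun b _ => hA.1 b
  have h1 := hc.conjTranspose_mul_mul_same (A a)
  have h2 := (hA.1 a).conjTranspose_mul_mul_same (1 - A a)
  rw [(hA.1 a).isHermitian.eq] at h1
  rw [hc.isHermitian.eq] at h2
  have e : A a - A a * A a
      = A a * (1 - A a) * A a + (1 - A a) * A a * (1 - A a) := by noncomm_ring
  rw [e]
  exact h1.add h2

/-- Two POVMs tested against the same family of positive functionals of total mass one. -/
lemma sum_abs_map_sub_le {n 𝒜 ℬ : Type*} [Fintype n] [DecidableEq n] [Fintype 𝒜] [Fintype ℬ]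
    (φ : ℬ → Matrix n n ℂ →ₗ[ℝ] ℝ)
    (hφ : ∀ b, ∀ M : Matrix n n ℂ, M.PosSemidef → 0 ≤ φ b M) (hone : ∑ b, φ b 1 = 1)
    {A Ahat : 𝒜 → Matrix n n ℂ} (hA : IsPOVM A) (hAhat : IsPOVM Ahat) :
    ∑ a, ∑ b, |φ b (A a) - φ b (Ahat a)|
      ≤ 2 * (1 - ∑ a, ∑ b, φ b (A a * A a))
        + 4 * √(∑ a, ∑ b, φ b ((A a - Ahat a) * (A a - Ahat a))) := by
  have hmass : ∀ {E : 𝒜 → Matrix n n ℂ}, IsPOVM E →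
      ∑ a, ∑ b, φ b (E a - E a * E a) = 1 - ∑ a, ∑ b, φ b (E a * E a) := fun {E} hE => by
    simp only [map_sub, Finset.sum_sub_distrib]
    rw [Finset.sum_comm]
    simp only [← map_sum, hE.2, hone]
  have hdef : ∀ {E : 𝒜 → Matrix n n ℂ}, IsPOVM E → ∀ a b, 0 ≤ φ b (E a - E a * E a) :=
    fun {E} hE a b => hφ b _ (hE.posSemidef_sub_mul_self a)
  have hle : ∀ {E : 𝒜 → Matrix n n ℂ}, IsPOVM E → ∑ a, ∑ b, φ b (E a * E a) ≤ 1 :=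
    fun {E} hE => by
      have h := Finset.sum_nonneg fun a (_ : a ∈ Finset.univ) =>
        Finset.sum_nonneg fun b (_ : b ∈ Finset.univ) => hdef hE a b
      rw [hmass hE] at h
      linarith
  have hsq : ∀ b, ∀ Z : Matrix n n ℂ, Z.IsHermitian → 0 ≤ φ b (Z * Z) := fun b Z hZ => by
    have h := hφ b _ (Matrix.posSemidef_conjTranspose_mul_self Z)
    rwa [hZ.eq] at h
  have hD : ∀ a, (A a - Ahat a).IsHermitian := fun a =>
    (hA.1 a).isHermitian.sub (hAhat.1 a).isHermitian
  have hS : ∀ a, (A a + Ahat a).IsHermitian := fun a =>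
    (hA.1 a).isHermitian.add (hAhat.1 a).isHermitian
  set D : 𝒜 → Matrix n n ℂ := fun a => (A a - Ahat a) * (A a - Ahat a) with hDdef
  set S : 𝒜 → Matrix n n ℂ := fun a => (A a + Ahat a) * (A a + Ahat a) with hSdef
  have hSbound : ∑ a, ∑ b, φ b (S a) ≤ 2 ^ 2 := by
    have h : ∀ a b, φ b (S a) ≤ 2 * φ b (A a * A a) + 2 * φ b (Ahat a * Ahat a) := fun a b => by
      have h0 : 0 ≤ φ b (D a) := hsq b _ (hD a)
      have e : S a + D a = A a * A a + A a * A a + (Ahat a * Ahat a + Ahat a * Ahat a) := by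
        simp only [hSdef, hDdef]
        noncomm_ring
      have e' := congrArg (φ b) e
      simp only [map_add] at e'
      linarith
    have h' := Finset.sum_le_sum fun a (_ : a ∈ Finset.univ) =>
      Finset.sum_le_sum fun b (_ : b ∈ Finset.univ) => h a b
    simp only [Finset.sum_add_distrib, ← Finset.mul_sum] at h'
    linarith [hle hA, hle hAhat]
  have hT : ∑ a, ∑ b, |φ b (A a * A a) - φ b (Ahat a * Ahat a)|
      ≤ 2 * √(∑ a, ∑ b, φ b (D a)) := by
    have h : ∀ a b, |φ b (A a * A a) - φ b (Ahat a * Ahat a)|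
        ≤ √(φ b (S a)) * √(φ b (D a)) := fun a b => by
      have h := abs_map_mul_add_mul_le (φ b) (hφ b) (hS a) (hD a)
      have e : (A a + Ahat a) * (A a - Ahat a) + (A a - Ahat a) * (A a + Ahat a)
          = (A a * A a - Ahat a * Ahat a) + (A a * A a - Ahat a * Ahat a) := by noncomm_ring
      rw [e, map_add, map_sub, ← two_mul, abs_mul, abs_two] at h
      linarith
    refine (Finset.sum_le_sum fun a _ => Finset.sum_le_sum fun b _ => h a b).trans ?_
    simp only [← Fintype.sum_prod_type']
    refine (Real.sum_sqrt_mul_sqrt_le Finset.univ (f := fun p : 𝒜 × ℬ => φ p.2 (S p.1))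
      (g := fun p : 𝒜 × ℬ => φ p.2 (D p.1)) (fun p => hsq p.2 _ (hS p.1))
      (fun p => hsq p.2 _ (hD p.1))).trans ?_
    refine mul_le_mul_of_nonneg_right ?_ (Real.sqrt_nonneg _)
    exact Real.sqrt_le_iff.2 ⟨by norm_num, (Fintype.sum_prod_type _).trans_le hSbound⟩
  have hpq : ∑ a, ∑ b, φ b (A a * A a) - ∑ a, ∑ b, φ b (Ahat a * Ahat a)
      ≤ ∑ a, ∑ b, |φ b (A a * A a) - φ b (Ahat a * Ahat a)| := by
    simp only [← Finset.sum_sub_distrib]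
    exact Finset.sum_le_sum fun a _ => Finset.sum_le_sum fun b _ => le_abs_self _
  have htri : ∀ a b, |φ b (A a) - φ b (Ahat a)| ≤ φ b (A a - A a * A a)
      + φ b (Ahat a - Ahat a * Ahat a) + |φ b (A a * A a) - φ b (Ahat a * Ahat a)| :=
    fun a b => by
      have h1 := hdef hA a b
      have h2 := hdef hAhat a b
      have h3 := neg_abs_le (φ b (A a * A a) - φ b (Ahat a * Ahat a))
      have h4 := le_abs_self (φ b (A a * A a) - φ b (Ahat a * Ahat a))
      rw [map_sub] at h1 h2 ⊢
      rw [map_sub]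
      exact abs_le.2 ⟨by linarith, by linarith⟩
  have htot := Finset.sum_le_sum fun a (_ : a ∈ Finset.univ) =>
    Finset.sum_le_sum fun b (_ : b ∈ Finset.univ) => htri a b
  simp only [Finset.sum_add_distrib] at htot
  rw [hmass hA, hmass hAhat] at htot
  linarith

/-- The functional `M ↦ ⟨ψ| M ⊗ B |ψ⟩`. -/
noncomputable def evKron {n₁ n₂ : Type*} [Fintype n₁] [Fintype n₂] (ψ : n₁ × n₂ → ℂ)
    (B : Matrix n₂ n₂ ℂ) : Matrix n₁ n₁ ℂ →ₗ[ℝ] ℝ where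
  toFun M := ev ψ (M ⊗ₖ B)
  map_add' M N := by simp [ev, Matrix.add_kronecker, Matrix.add_mulVec, dotProduct_add]
  map_smul' t M := by simp [ev, Matrix.smul_kronecker, Matrix.smul_mulVec, dotProduct_smul]

lemma evKron_nonneg {n₁ n₂ : Type*} [Fintype n₁] [Fintype n₂] (ψ : n₁ × n₂ → ℂ)
    {B : Matrix n₂ n₂ ℂ} (hB : B.PosSemidef) {M : Matrix n₁ n₁ ℂ} (hM : M.PosSemidef) :
    0 ≤ evKron ψ B M :=
  (Complex.le_def.1 ((hM.kronecker hB).dotProduct_mulVec_nonneg ψ)).1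

lemma ev_sum {m ι : Type*} [Fintype m] (ψ : m → ℂ) (s : Finset ι) (M : ι → Matrix m m ℂ) :
    ev ψ (∑ i ∈ s, M i) = ∑ i ∈ s, ev ψ (M i) := by
  simp [ev, Matrix.sum_mulVec, dotProduct_sum]

lemma ev_kronecker_sum {n₁ n₂ ι : Type*} [Fintype n₁] [Fintype n₂] [Fintype ι]
    (ψ : n₁ × n₂ → ℂ) (M : Matrix n₁ n₁ ℂ) (B : ι → Matrix n₂ n₂ ℂ) :
    ev ψ (M ⊗ₖ ∑ i, B i) = ∑ i, ev ψ (M ⊗ₖ B i) := by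
  rw [← ev_sum]
  congr 1
  ext p q
  simp [Matrix.kroneckerMap_apply, Matrix.sum_apply, Finset.mul_sum]

lemma ev_kronecker {n₁ n₂ : Type*} [Fintype n₁] [Fintype n₂] (N : Matrix n₂ n₁ ℂ)
    (M : Matrix n₁ n₁ ℂ) (B : Matrix n₂ n₂ ℂ) :
    ev (Matrix.vec N) (M ⊗ₖ B) = (Nᴴ * (B * N * Mᵀ)).trace.re := by
  rw [ev, Matrix.kronecker_mulVec_vec, Matrix.star_vec_dotProduct_vec]

lemma ev_kronecker_one {n₁ n₂ : Type*} [Fintype n₁] [Fintype n₂] [DecidableEq n₂]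
    (ψ : n₁ × n₂ → ℂ) (M : Matrix n₁ n₁ ℂ) :
    ev ψ (M ⊗ₖ (1 : Matrix n₂ n₂ ℂ)) = (M * rhoA ψ).trace.re := by
  set N : Matrix n₂ n₁ ℂ := Matrix.of fun j i => ψ (i, j)
  have hψ : ψ = Matrix.vec N := rfl
  have hρ : rhoA ψ = (Nᴴ * N)ᵀ := by
    ext i j
    simp [rhoA, N, Matrix.mul_apply, mul_comm]
  rw [hρ, hψ, ev_kronecker, Matrix.one_mul, ← Matrix.mul_assoc, ← Matrix.trace_transpose,
    Matrix.transpose_mul, Matrix.transpose_transpose]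

lemma ev_purif_kronecker_transposeB {n : Type*} [Fintype n] [DecidableEq n]
    {U : Matrix n n ℂ} (hU : Uᴴ * U = 1) (lam : n → ℝ) (X Y : Matrix n n ℂ) :
    ev (purif U lam) (X ⊗ₖ transposeB U Y)
      = ∑ k, ∑ l, √(lam k) * √(lam l) * ((Uᴴ * X * U) k l * (Uᴴ * Y * U) l k).re := by
  set D : Matrix n n ℂ := Matrix.diagonal fun k => (√(lam k) : ℂ) with hD
  have hψ : purif U lam = Matrix.vec (U * D * Uᵀ) := by
    ext p
    rw [purif, Matrix.vec, Matrix.mul_apply]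
    refine Finset.sum_congr rfl fun k _ => ?_
    rw [hD, Matrix.mul_diagonal, Matrix.transpose_apply]
    ring
  have hDD : Dᴴ = D := by
    simp [hD, Matrix.diagonal_conjTranspose, Pi.star_def]
  have e : ((U * D * Uᵀ)ᴴ * (transposeB U Y * (U * D * Uᵀ) * Xᵀ)).trace
      = (D * (Uᴴ * Y * U)ᵀ * (D * (Uᴴ * X * U)ᵀ)).trace := by
    have h1 : (U * D * Uᵀ)ᴴ * (transposeB U Y * (U * D * Uᵀ) * Xᵀ)
        = Uᵀᴴ * (D * ((Uᴴ * U) * (Uᴴ * Y * U)ᵀ * (Uᴴ * U)) * D * Uᵀ * Xᵀ) := by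
      simp only [transposeB, Matrix.conjTranspose_mul, hDD, Matrix.mul_assoc]
    have h2 : (Uᴴ * X * U)ᵀ = Uᵀ * Xᵀ * Uᵀᴴ := by
      simp only [Matrix.transpose_mul, Matrix.mul_assoc]
      rfl
    rw [h1, hU, Matrix.one_mul, Matrix.mul_one, Matrix.trace_mul_comm, h2]
    simp only [Matrix.mul_assoc]
  rw [hψ, ev_kronecker, e]
  rw [Matrix.trace, Complex.re_sum]
  refine Finset.sum_congr rfl fun k _ => ?_
  rw [Matrix.diag_apply, Matrix.mul_apply, Complex.re_sum]
  refine Finset.sum_congr rfl fun l _ => ?_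
  rw [hD, Matrix.diagonal_mul, Matrix.diagonal_mul, Matrix.transpose_apply,
    Matrix.transpose_apply]
  rw [← Complex.re_ofReal_mul]
  congr 1
  push_cast
  ring

lemma trace_mul_spectral_re {n : Type*} [Fintype n] [DecidableEq n]
    (U : Matrix n n ℂ) (lam : n → ℝ) (X : Matrix n n ℂ) :
    (X * (U * Matrix.diagonal (fun i => (lam i : ℂ)) * Uᴴ)).trace.re
      = ∑ k, lam k * ((Uᴴ * X * U) k k).re := by
  have e : (X * (U * Matrix.diagonal (fun i => (lam i : ℂ)) * Uᴴ)).trace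
      = (Uᴴ * X * U * Matrix.diagonal (fun i => (lam i : ℂ))).trace := by
    rw [← Matrix.mul_assoc, Matrix.trace_mul_comm]
    simp only [Matrix.mul_assoc]
  rw [e]
  simp [Matrix.trace, Matrix.mul_diagonal, mul_comm]

lemma ev_purif_self_le {n : Type*} [Fintype n] [DecidableEq n]
    {U : Matrix n n ℂ} (hU : Uᴴ * U = 1) {lam : n → ℝ} (hlam : ∀ i, 0 ≤ lam i)
    {X : Matrix n n ℂ} (hX : X.IsHermitian) :
    ev (purif U lam) (X ⊗ₖ transposeB U X)
      ≤ (X * X * (U * Matrix.diagonal (fun i => (lam i : ℂ)) * Uᴴ)).trace.re := by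
  set Z := Uᴴ * X * U with hZdef
  have hZ : Z.IsHermitian := Matrix.isHermitian_conjTranspose_mul_mul U hX
  have hZZ : Uᴴ * (X * X) * U = Z * Z := by
    have hU' : U * Uᴴ = 1 := mul_eq_one_comm.1 hU
    calc Uᴴ * (X * X) * U = Uᴴ * X * 1 * (X * U) := by simp only [Matrix.mul_assoc, Matrix.one_mul]
      _ = Z * Z := by rw [← hU']; simp only [hZdef, Matrix.mul_assoc]
  have hentry : ∀ k l, (Z k l * Z l k).re = Complex.normSq (Z k l) := fun k l => by
    rw [← hZ.apply l k, Complex.star_def, Complex.mul_conj, Complex.ofReal_re]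
  have hsymm : ∀ k l, Complex.normSq (Z k l) = Complex.normSq (Z l k) := fun k l => by
    rw [← hentry, ← hentry, mul_comm]
  rw [ev_purif_kronecker_transposeB hU, trace_mul_spectral_re, hZZ]
  simp only [← hZdef]
  simp only [Matrix.mul_apply, Complex.re_sum, hentry, Finset.mul_sum]
  have hswap : ∑ k, ∑ l, lam k * Complex.normSq (Z k l)
      = ∑ k, ∑ l, lam l * Complex.normSq (Z k l) := by
    rw [Finset.sum_comm]
    exact Finset.sum_congr rfl fun k _ => Finset.sum_congr rfl fun l _ => by rw [hsymm]
  have hle : ∑ k, ∑ l, 2 * (√(lam k) * √(lam l) * Complex.normSq (Z k l))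
      ≤ ∑ k, ∑ l, (lam k * Complex.normSq (Z k l) + lam l * Complex.normSq (Z k l)) := by
    refine Finset.sum_le_sum fun k _ => Finset.sum_le_sum fun l _ => ?_
    have h := two_mul_le_add_sq √(lam k) √(lam l)
    rw [Real.sq_sqrt (hlam k), Real.sq_sqrt (hlam l)] at h
    nlinarith [mul_le_mul_of_nonneg_right h (Complex.normSq_nonneg (Z k l))]
  simp only [Finset.sum_add_distrib, ← hswap, ← Finset.mul_sum] at hle
  simp only [← Finset.mul_sum]
  linarith

lemma transposeB_sum {n ι : Type*} [Fintype n] [Fintype ι] (U : Matrix n n ℂ)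
    (X : ι → Matrix n n ℂ) : transposeB U (∑ i, X i) = ∑ i, transposeB U (X i) := by
  simp only [transposeB, Matrix.mul_sum, Matrix.sum_mul, Matrix.transpose_sum]

/-- The synchronicity default of a POVM on the canonical purification controls its
non-projectivity in the state. -/
lemma one_sub_sum_trace_sq_le {n 𝒜 : Type*} [Fintype n] [DecidableEq n] [Fintype 𝒜]
    [DecidableEq 𝒜] {U : Matrix n n ℂ} (hU : Uᴴ * U = 1) {lam : n → ℝ}
    (hlam : ∀ i, 0 ≤ lam i) (hsum : ∑ i, lam i = 1) {A : 𝒜 → Matrix n n ℂ} (hA : IsPOVM A) :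
    1 - ∑ a, (A a * A a * (U * Matrix.diagonal (fun i => (lam i : ℂ)) * Uᴴ)).trace.re
      ≤ ∑ a, ∑ b, if a = b then 0 else ev (purif U lam) (A a ⊗ₖ transposeB U (A b)) := by
  have htotal : ∑ a, ∑ b, ev (purif U lam) (A a ⊗ₖ transposeB U (A b)) = 1 := by
    have h : ∀ a, ∑ b, ev (purif U lam) (A a ⊗ₖ transposeB U (A b))
        = evKron (purif U lam) (transposeB U 1) (A a) := fun a => by
      rw [← ev_kronecker_sum, ← transposeB_sum, hA.2]
      rfl
    simp only [h, ← map_sum, hA.2]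
    change ev _ _ = 1
    rw [ev_purif_kronecker_transposeB hU, ← hsum, Matrix.mul_one, hU]
    refine Finset.sum_congr rfl fun k _ => ?_
    rw [Finset.sum_eq_single k]
    · simp [Real.mul_self_sqrt (hlam k)]
    · intro l _ hl
      simp [Matrix.one_apply, hl]
    · simp
  have hsplit : ∑ a, ∑ b, (if a = b then 0 else ev (purif U lam) (A a ⊗ₖ transposeB U (A b)))
      = 1 - ∑ a, ev (purif U lam) (A a ⊗ₖ transposeB U (A a)) := by
    rw [← htotal, ← Finset.sum_sub_distrib]
    refine Finset.sum_congr rfl fun a _ => ?_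
    rw [eq_sub_iff_add_eq, ← Finset.add_sum_erase _ _ (Finset.mem_univ a),
      ← Finset.add_sum_erase (a := a) _
        (fun b => ev (purif U lam) (A a ⊗ₖ transposeB U (A b))) (Finset.mem_univ a)]
    rw [if_pos rfl, zero_add, add_comm]
    congr 1
    exact Finset.sum_congr rfl fun b hb => if_neg (Finset.ne_of_mem_erase hb).symm
  rw [hsplit]
  have := Finset.sum_le_sum fun a (_ : a ∈ Finset.univ) =>
    ev_purif_self_le hU hlam (hA.1 a).isHermitian
  linarith

/-- nearby measurements induce nearby correlations (Lemma `close-cor`):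
`E_{(x,y)∼ν} Σ_{a,b} |C_{xyab} − Ĉ_{xyab}| ≤ K (δ + √γ)`. -/
theorem stmt4 :
    ∃ K : ℝ, 0 < K ∧
    ∀ (n₁ n₂ : ℕ) (𝒳 𝒴 𝒜 ℬ : Type)
      [Fintype 𝒳] [Fintype 𝒴] [Fintype 𝒜] [DecidableEq 𝒜] [Fintype ℬ]
      (ψ : Fin n₁ × Fin n₂ → ℂ) (_hψ : nsq ψ = 1)
      (A Ahat : 𝒳 → 𝒜 → Matrix (Fin n₁) (Fin n₁) ℂ)
      (B : 𝒴 → ℬ → Matrix (Fin n₂) (Fin n₂) ℂ)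
      (_hA : ∀ x, IsPOVM (A x)) (_hAhat : ∀ x, IsPOVM (Ahat x)) (_hB : ∀ y, IsPOVM (B y))
      (U : Matrix (Fin n₁) (Fin n₁) ℂ) (lamA : Fin n₁ → ℝ)
      (_hU : Uᴴ * U = 1) (_hlam : ∀ i, 0 ≤ lamA i)
      (_hdec : rhoA ψ = U * Matrix.diagonal (fun i => (lamA i : ℂ)) * Uᴴ)
      (ν : 𝒳 × 𝒴 → ℝ) (_hν : IsDist ν)
      (δ γ : ℝ)
      (_hδ : δ = deltaSync (fun x => ∑ y, ν (x, y)) (purif U lamA) A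
          (fun x a => transposeB U (A x a)))
      (_hγ : γ = ∑ x, (∑ y, ν (x, y)) *
          ∑ a, (((A x a - Ahat x a) * (A x a - Ahat x a) * rhoA ψ).trace).re),
      ∑ x, ∑ y, ν (x, y) * ∑ a, ∑ b,
          |corr ψ A B x y a b - corr ψ Ahat B x y a b|
        ≤ K * (δ + Real.sqrt γ) := by
  refine ⟨4, by norm_num, ?_⟩
  intro n₁ n₂ 𝒳 𝒴 𝒜 ℬ _ _ _ _ _ ψ hψ A Ahat B hA hAhat hB U lam hU hlam hdec ν hν δ γ hδ hγ
  have htr : (1 * rhoA ψ).trace.re = 1 := by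
    rw [← hψ, Matrix.one_mul, Matrix.trace, Complex.re_sum, nsq, Fintype.sum_prod_type]
    simp [rhoA, Complex.mul_conj]
  have hsum : ∑ i, lam i = 1 := by
    rw [← htr, hdec, trace_mul_spectral_re, Matrix.mul_one, hU]
    simp
  set μ : 𝒳 → ℝ := fun x => ∑ y, ν (x, y) with hμ
  have hμ0 : ∀ x, 0 ≤ μ x := fun x => Finset.sum_nonneg fun y _ => hν.1 _
  have hμ1 : ∑ x, μ x = 1 := by rw [← hν.2, Fintype.sum_prod_type]
  set d : 𝒳 → ℝ := fun x => ∑ a, ∑ b, if a = b then 0 else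
    ev (purif U lam) (A x a ⊗ₖ transposeB U (A x b)) with hd
  set g : 𝒳 → ℝ := fun x =>
    ∑ a, (((A x a - Ahat x a) * (A x a - Ahat x a) * rhoA ψ).trace).re with hg
  have hmarg : ∀ y M, ∑ b, evKron ψ (B y b) M = (M * rhoA ψ).trace.re := fun y M => by
    rw [← ev_kronecker_one, ← (hB y).2, ev_kronecker_sum]
    rfl
  have hg0 : ∀ x, 0 ≤ g x := fun x => Finset.sum_nonneg fun a _ => by
    rw [← ev_kronecker_one]
    have hD : (A x a - Ahat x a).IsHermitian :=
      ((hA x).1 a).isHermitian.sub ((hAhat x).1 a).isHermitian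
    have h := Matrix.posSemidef_conjTranspose_mul_self (A x a - Ahat x a)
    rw [hD.eq] at h
    exact evKron_nonneg ψ Matrix.PosSemidef.one h
  have hpt : ∀ x y, ∑ a, ∑ b, |corr ψ A B x y a b - corr ψ Ahat B x y a b|
      ≤ 2 * d x + 4 * √(g x) := fun x y => by
    have h := sum_abs_map_sub_le (fun b => evKron ψ (B y b))
      (fun b M hM => evKron_nonneg ψ ((hB y).1 b) hM) ((hmarg y 1).trans htr) (hA x) (hAhat x)
    simp only [hmarg] at h
    have h' := one_sub_sum_trace_sq_le hU hlam hsum (hA x)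
    rw [← hdec] at h'
    change _ ≤ 2 * _ + 4 * √(g x) at h
    change _ ≤ d x at h'
    refine le_trans h ?_
    linarith
  have hd0 : 0 ≤ δ := by
    rw [hδ]
    refine Finset.sum_nonneg fun x _ => mul_nonneg (hμ0 x) ?_
    have h' := one_sub_sum_trace_sq_le hU hlam hsum (hA x)
    refine le_trans ?_ h'
    rw [← hdec]
    have hA1 : ∑ a, (A x a * rhoA ψ).trace.re = 1 := by
      rw [← htr, ← (hA x).2, Finset.sum_mul, Matrix.trace_sum, Complex.re_sum]
    rw [← hA1, ← Finset.sum_sub_distrib]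
    refine Finset.sum_nonneg fun a _ => ?_
    rw [← Complex.sub_re, ← Matrix.trace_sub, ← Matrix.sub_mul, ← ev_kronecker_one]
    exact evKron_nonneg ψ Matrix.PosSemidef.one ((hA x).posSemidef_sub_mul_self a)
  have hδ' : δ = ∑ x, μ x * d x := hδ
  have hjensen : ∑ x, μ x * √(g x) ≤ √γ := by
    have h := Real.sum_sqrt_mul_sqrt_le Finset.univ hμ0 (fun x => mul_nonneg (hμ0 x) (hg0 x))
    rw [hμ1, Real.sqrt_one, one_mul, ← hγ] at h
    refine le_trans (le_of_eq ?_) h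
    refine Finset.sum_congr rfl fun x _ => ?_
    rw [Real.sqrt_mul (hμ0 x), ← mul_assoc, Real.mul_self_sqrt (hμ0 x)]
  calc ∑ x, ∑ y, ν (x, y) * ∑ a, ∑ b, |corr ψ A B x y a b - corr ψ Ahat B x y a b|
      ≤ ∑ x, ∑ y, ν (x, y) * (2 * d x + 4 * √(g x)) :=
        Finset.sum_le_sum fun x _ => Finset.sum_le_sum fun y _ =>
          mul_le_mul_of_nonneg_left (hpt x y) (hν.1 _)
    _ = 2 * δ + 4 * ∑ x, μ x * √(g x) := by
        rw [hδ', Finset.mul_sum, Finset.mul_sum, ← Finset.sum_add_distrib]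
        refine Finset.sum_congr rfl fun x _ => ?_
        rw [← Finset.sum_mul]
        ring
    _ ≤ 4 * (δ + √γ) := by linarith

end AlmostSync
end

section
/- There is a universal constant K > 0 such that the following holds. Let 0 ≤ δ ≤ 1, let H be a finite-dimensional complex Hilbert space, and let |ψ⟩ = Σ_i √λ_i |u_i⟩|u_i⟩ ∈ H ⊗ H be a unit vector with λ_i ≥ 0 and {|u_i⟩} orthonormal (transposes below are taken with respect to {|u_i⟩}). Let k be a positive integer and Q_1, …, Q_k positive semidefinite operators on H with Σ_i Q_i = Id, and suppose δ = 1 − Σ_i ⟨ψ| Q_i ⊗ Q_i^T |ψ⟩. Then there exist orthogonal projections P_1, …, P_k on H with Σ_i P_i = Id such that Σ_i ⟨ψ| (P_i − Q_i)² ⊗ Id |ψ⟩ ≤ K δ^{1/4}. -/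
open scoped Kronecker ComplexOrder
open Matrix MeasureTheory

attribute [local instance] Matrix.normedAddCommGroup Matrix.normedSpace

namespace AlmostSync

/-- Real part of the Hilbert-Schmidt inner product. -/
noncomputable def hsInner {m n : Type*} [Fintype m] [Fintype n] (X Y : Matrix m n ℂ) : ℝ :=
  ((Xᴴ * Y).trace).re

section HilbertSchmidt

variable {m n : Type*} [Fintype m] [Fintype n]

lemma hsInner_add_left (X Y Z : Matrix m n ℂ) :
    hsInner (X + Y) Z = hsInner X Z + hsInner Y Z := by
  simp [hsInner, Matrix.add_mul]

lemma hsInner_add_right (X Y Z : Matrix m n ℂ) :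
    hsInner X (Y + Z) = hsInner X Y + hsInner X Z := by
  simp [hsInner, Matrix.mul_add]

lemma hsInner_sub_left (X Y Z : Matrix m n ℂ) :
    hsInner (X - Y) Z = hsInner X Z - hsInner Y Z := by
  simp [hsInner, Matrix.sub_mul]

lemma hsInner_sub_right (X Y Z : Matrix m n ℂ) :
    hsInner X (Y - Z) = hsInner X Y - hsInner X Z := by
  simp [hsInner, Matrix.mul_sub]

lemma hsInner_smul_left (c : ℝ) (X Y : Matrix m n ℂ) :
    hsInner (c • X) Y = c * hsInner X Y := by
  simp [hsInner, Matrix.conjTranspose_smul]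

lemma hsInner_smul_right (c : ℝ) (X Y : Matrix m n ℂ) :
    hsInner X (c • Y) = c * hsInner X Y := by
  simp [hsInner]

lemma hsInner_sum_right {ι : Type*} (s : Finset ι) (X : Matrix m n ℂ) (Y : ι → Matrix m n ℂ) :
    hsInner X (∑ i ∈ s, Y i) = ∑ i ∈ s, hsInner X (Y i) := by
  simp [hsInner, Matrix.mul_sum, Matrix.trace_sum]

lemma hsInner_comm (X Y : Matrix m n ℂ) : hsInner X Y = hsInner Y X := by
  have h : Yᴴ * X = (Xᴴ * Y)ᴴ := by simp
  rw [hsInner, hsInner, h, Matrix.trace_conjTranspose]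
  simp

lemma hsInner_self_nonneg (X : Matrix m n ℂ) : 0 ≤ hsInner X X :=
  (Complex.le_def.mp (Matrix.posSemidef_conjTranspose_mul_self X).trace_nonneg).1

lemma hsInner_mul_left {l : Type*} [Fintype l] (B : Matrix l m ℂ) (X : Matrix m n ℂ)
    (Y : Matrix l n ℂ) : hsInner (B * X) Y = hsInner X (Bᴴ * Y) := by
  simp [hsInner, Matrix.mul_assoc]

lemma hsInner_conjTranspose (X Y : Matrix m n ℂ) : hsInner Xᴴ Yᴴ = hsInner X Y := by
  rw [hsInner_comm X Y, hsInner, hsInner, Matrix.conjTranspose_conjTranspose,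
    Matrix.trace_mul_comm]

lemma two_mul_hsInner_le {c : ℝ} (hc : 0 < c) (X Y : Matrix m n ℂ) :
    2 * hsInner X Y ≤ c * hsInner X X + c⁻¹ * hsInner Y Y := by
  have h := hsInner_self_nonneg (c • X - Y)
  simp only [hsInner_sub_left, hsInner_sub_right, hsInner_smul_left, hsInner_smul_right] at h
  rw [hsInner_comm Y X] at h
  have h2 := mul_nonneg (inv_pos.mpr hc).le h
  have h3 : c⁻¹ * (c * (c * hsInner X X) - c * hsInner X Y - (c * hsInner X Y - hsInner Y Y))
      = c * hsInner X X + c⁻¹ * hsInner Y Y - 2 * hsInner X Y := by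
    field_simp
    ring
  linarith

lemma neg_two_mul_hsInner_le {c : ℝ} (hc : 0 < c) (X Y : Matrix m n ℂ) :
    -2 * hsInner X Y ≤ c * hsInner X X + c⁻¹ * hsInner Y Y := by
  have h := two_mul_hsInner_le hc X ((-1 : ℝ) • Y)
  simp only [hsInner_smul_left, hsInner_smul_right] at h
  linarith

lemma hsInner_add_self_le (X Y : Matrix m n ℂ) :
    hsInner (X + Y) (X + Y) ≤ 2 * hsInner X X + 2 * hsInner Y Y := by
  have h := two_mul_hsInner_le one_pos X Y
  simp only [hsInner_add_left, hsInner_add_right, hsInner_comm Y X]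
  linarith

lemma hsInner_sub_self_le (X Y : Matrix m n ℂ) :
    hsInner (X - Y) (X - Y) ≤ 2 * hsInner X X + 2 * hsInner Y Y := by
  have h := hsInner_self_nonneg (X + Y)
  simp only [hsInner_add_left, hsInner_add_right, hsInner_sub_left, hsInner_sub_right,
    hsInner_comm Y X] at h ⊢
  linarith

lemma hsInner_mul_nonneg {T : Matrix m m ℂ} (hT : T.PosSemidef) (X : Matrix m n ℂ) :
    0 ≤ hsInner X (T * X) := by
  rw [hsInner, ← Matrix.mul_assoc]
  exact (Complex.le_def.mp (hT.conjTranspose_mul_mul_same X).trace_nonneg).1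

lemma hsInner_proj_mul {E : Matrix m m ℂ} (hE : Eᴴ = E) (hE2 : E * E = E) (X Y : Matrix m n ℂ) :
    hsInner (E * X) (E * Y) = hsInner X (E * Y) := by
  rw [hsInner_mul_left, hE, ← Matrix.mul_assoc, hE2]

lemma hsInner_one_sub_mul_le [DecidableEq m] {T : Matrix m m ℂ} (hT : T.PosSemidef)
    (Y : Matrix m n ℂ) :
    hsInner ((1 - T) * Y) ((1 - T) * Y) ≤ hsInner ((1 - T * T) * Y) ((1 - T * T) * Y) := by
  have h : (1 - T * T) * Y = (1 - T) * Y + T * ((1 - T) * Y) := by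
    simp only [Matrix.sub_mul, Matrix.mul_sub, Matrix.one_mul, Matrix.mul_assoc]
    abel
  rw [h]
  have h1 := hsInner_mul_nonneg hT ((1 - T) * Y)
  have h2 := hsInner_self_nonneg (T * ((1 - T) * Y))
  simp only [hsInner_add_left, hsInner_add_right, hsInner_comm (T * ((1 - T) * Y)) ((1 - T) * Y)]
  linarith

lemma hsInner_sum_smul_proj_mul {σ : Type*} [Fintype σ]
    {E : σ → Matrix m m ℂ} (hE : ∀ s, (E s)ᴴ = E s) (hE2 : ∀ s, E s * E s = E s)
    (c : σ → ℝ) (X Y : Matrix m n ℂ) :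
    hsInner X ((∑ s, c s • E s) * Y) = ∑ s, c s * hsInner (E s * X) (E s * Y) := by
  rw [Matrix.sum_mul, hsInner_sum_right]
  refine Finset.sum_congr rfl fun s _ => ?_
  rw [hsInner_proj_mul (hE s) (hE2 s), Matrix.smul_mul, hsInner_smul_right]

/-- A signed combination `∑ c s • E s` of projections, dominated by a resolution
`∑ a s • E s = 1` of the identity, is controlled by its absolute weights. -/
lemma hsInner_sum_smul_proj_mul_le [DecidableEq m] {σ : Type*} [Fintype σ]
    {E : σ → Matrix m m ℂ} (hE : ∀ s, (E s)ᴴ = E s) (hE2 : ∀ s, E s * E s = E s)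
    {a c : σ → ℝ} (hca : ∀ s, |c s| ≤ a s) (ha : ∑ s, a s • E s = 1) (Y : Matrix m n ℂ) :
    hsInner ((∑ s, c s • E s) * Y) ((∑ s, c s • E s) * Y)
      ≤ ∑ s, |c s| * hsInner (E s * Y) (E s * Y) := by
  set Z := (∑ s, c s • E s) * Y with hZ
  have h1 : hsInner Z Z = ∑ s, c s * hsInner (E s * Z) (E s * Y) :=
    hsInner_sum_smul_proj_mul hE hE2 c Z Y
  have h2 : hsInner Z Z = ∑ s, a s * hsInner (E s * Z) (E s * Z) := by
    rw [← hsInner_sum_smul_proj_mul hE hE2, ha, Matrix.one_mul]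
  have h3 : ∀ s, 2 * (c s * hsInner (E s * Z) (E s * Y))
      ≤ a s * hsInner (E s * Z) (E s * Z) + |c s| * hsInner (E s * Y) (E s * Y) := by
    intro s
    have q1 := hsInner_self_nonneg (E s * Z + E s * Y)
    have q2 := hsInner_self_nonneg (E s * Z - E s * Y)
    have q3 := hsInner_self_nonneg (E s * Z)
    simp only [hsInner_add_left, hsInner_add_right, hsInner_sub_left, hsInner_sub_right,
      hsInner_comm (E s * Y) (E s * Z)] at q1 q2
    have hs := mul_le_mul_of_nonneg_right (hca s) q3
    rcases abs_cases (c s) with ⟨h, h0⟩ | ⟨h, h0⟩ <;> rw [h] at hs ⊢ <;> nlinarith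
  have h4 := Finset.sum_le_sum fun s (_ : s ∈ Finset.univ) => h3 s
  rw [Finset.sum_add_distrib, ← Finset.mul_sum, ← h1, ← h2] at h4
  linarith

end HilbertSchmidt

lemma exists_isometry_mul_posSemidef {n : Type*} [Fintype n] [DecidableEq n]
    (X : Matrix n n ℂ) :
    ∃ V T : Matrix n n ℂ, V * Vᴴ = 1 ∧ T.PosSemidef ∧ T * T = Xᴴ * X ∧ X = V * T := by
  obtain ⟨T, hT, hTT⟩ : ∃ T : Matrix n n ℂ, T.PosSemidef ∧ T * T = Xᴴ * X := by
    open scoped MatrixOrder in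
    have hX := (Matrix.posSemidef_conjTranspose_mul_self X).nonneg
    exact ⟨CFC.sqrt (Xᴴ * X), (CFC.sqrt_nonneg _).posSemidef, CFC.sqrt_mul_sqrt_self _ hX⟩
  have hnorm : ∀ v, ‖Matrix.toEuclideanLin T v‖ = ‖Matrix.toEuclideanLin X v‖ := by
    have key : ∀ (M : Matrix n n ℂ) v, ‖Matrix.toEuclideanLin M v‖ ^ 2
        = (star v.ofLp ⬝ᵥ (Mᴴ * M) *ᵥ v.ofLp).re := by
      intro M v
      rw [← Matrix.mulVec_mulVec, Matrix.dotProduct_mulVec, ← Matrix.star_mulVec,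
        ← inner_self_eq_norm_sq (𝕜 := ℂ), EuclideanSpace.inner_eq_star_dotProduct,
        dotProduct_comm]
      rfl
    intro v
    rw [← sq_eq_sq₀ (norm_nonneg _) (norm_nonneg _), key, key, hT.1.eq, hTT]
  obtain ⟨g, hg⟩ := (Matrix.toEuclideanLin T).rangeRestrict.exists_rightInverse_of_surjective
    (LinearMap.range_rangeRestrict _)
  have hg' : ∀ y, Matrix.toEuclideanLin T (g y) = y := fun y =>
    congrArg Subtype.val (LinearMap.congr_fun hg y)
  let L : LinearMap.range (Matrix.toEuclideanLin T) →ₗᵢ[ℂ] EuclideanSpace ℂ n :=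
    { toLinearMap := Matrix.toEuclideanLin X ∘ₗ g
      norm_map' := fun y => by
        rw [LinearMap.comp_apply, ← hnorm, hg']
        rfl }
  have hL : ∀ v, L.extend (Matrix.toEuclideanLin T v) = Matrix.toEuclideanLin X v := by
    intro v
    have h := L.extend_apply ⟨Matrix.toEuclideanLin T v, LinearMap.mem_range_self _ v⟩
    refine h.trans ?_
    change Matrix.toEuclideanLin X (g _) = _
    rw [← sub_eq_zero, ← map_sub, ← norm_eq_zero, ← hnorm, map_sub, hg', sub_self, norm_zero]
  set V := Matrix.toEuclideanLin.symm L.extend.toLinearMap with hV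
  have hV' : ∀ v, Matrix.toEuclideanLin V v = L.extend v := fun v => by
    rw [hV, LinearEquiv.apply_symm_apply]
    rfl
  have hVV : Vᴴ * V = 1 := by
    ext i j
    have h := L.extend.inner_map_map (EuclideanSpace.single i (1 : ℂ)) (EuclideanSpace.single j 1)
    rw [← hV', ← hV', EuclideanSpace.inner_eq_star_dotProduct] at h
    rw [EuclideanSpace.inner_single_left] at h
    simp only [Matrix.toLpLin_apply, PiLp.ofLp_single, Matrix.mulVec_single_one] at h
    rw [dotProduct_comm] at h
    refine h.trans ?_
    simp [Matrix.one_apply, Pi.single_apply]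
  refine ⟨V, T, mul_eq_one_comm.mp hVV, hT, hTT, ?_⟩
  apply Matrix.toEuclideanLin.injective
  ext1 v
  rw [← hL, ← hV']
  simp [Matrix.toLpLin_apply, Matrix.mulVec_mulVec]

/-- Rounding: among the indices of a finite set, at most `d` can be kept so that the discarded
weight is at most the fractional defect. -/
lemma exists_subset_card_le_sum_sdiff_le {σ : Type*} [DecidableEq σ] (B : Finset σ)
    {a w : σ → ℝ} (ha0 : ∀ s, 0 ≤ a s) (ha1 : ∀ s, a s ≤ 1) (hw : ∀ s, 0 ≤ w s) {d : ℕ}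
    (hd : ∑ s ∈ B, a s ≤ d) :
    ∃ T ⊆ B, T.card ≤ d ∧ ∑ s ∈ B \ T, w s ≤ ∑ s ∈ B, (1 - a s) * w s := by
  rcases le_total B.card d with h | h
  · exact ⟨B, subset_rfl, h, by
      simpa using Finset.sum_nonneg fun s _ => mul_nonneg (sub_nonneg.mpr (ha1 s)) (hw s)⟩
  obtain ⟨T, hT, hmax⟩ := Finset.exists_max_image (B.powersetCard d) (fun T => ∑ s ∈ T, w s)
    (Finset.powersetCard_nonempty.mpr h)
  obtain ⟨hTB, hTd⟩ := Finset.mem_powersetCard.mp hT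
  refine ⟨T, hTB, hTd.le, ?_⟩
  have hsw : ∀ t ∈ T, ∀ s ∈ B \ T, w s ≤ w t := by
    intro t ht s hs
    obtain ⟨hsB, hsT⟩ := Finset.mem_sdiff.mp hs
    have hs' : s ∉ T.erase t := fun h' => hsT (Finset.mem_of_mem_erase h')
    have h1 := hmax (insert s (T.erase t)) (Finset.mem_powersetCard.mpr ⟨
      Finset.insert_subset hsB ((Finset.erase_subset _ _).trans hTB), by
        rw [Finset.card_insert_of_notMem hs', Finset.card_erase_add_one ht, hTd]⟩)
    rw [Finset.sum_insert hs', ← Finset.add_sum_erase T w ht] at h1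
    linarith
  have hθ : ∃ θ : ℝ, 0 ≤ θ ∧ (∀ t ∈ T, θ ≤ w t) ∧ ∀ s ∈ B \ T, a s * w s ≤ a s * θ := by
    rcases T.eq_empty_or_nonempty with rfl | hne
    · have hsum : ∑ s ∈ B, a s = 0 := le_antisymm (by simpa [← hTd] using hd)
        (Finset.sum_nonneg fun s _ => ha0 s)
      rw [Finset.sum_eq_zero_iff_of_nonneg fun s _ => ha0 s] at hsum
      exact ⟨0, le_rfl, by simp, fun s hs => by simp [hsum s (Finset.mem_sdiff.mp hs).1]⟩
    · obtain ⟨t, ht, hmin⟩ := Finset.exists_min_image T w hne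
      exact ⟨w t, hw t, hmin, fun s hs => mul_le_mul_of_nonneg_left (hsw t ht s hs) (ha0 s)⟩
  obtain ⟨θ, hθ0, hθT, hθB⟩ := hθ
  have e1 : ∑ s ∈ B, (1 - a s) * w s
      = ∑ s ∈ B \ T, (1 - a s) * w s + ∑ s ∈ T, (1 - a s) * w s :=
    (Finset.sum_sdiff hTB).symm
  have e2 : ∑ s ∈ B, a s = ∑ s ∈ B \ T, a s + ∑ s ∈ T, a s := (Finset.sum_sdiff hTB).symm
  have e3 : ∑ s ∈ T, (1 - a s) * θ ≤ ∑ s ∈ T, (1 - a s) * w s :=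
    Finset.sum_le_sum fun s hs => mul_le_mul_of_nonneg_left (hθT s hs) (sub_nonneg.mpr (ha1 s))
  have e4 := Finset.sum_le_sum hθB
  rw [← Finset.sum_mul, Finset.sum_sub_distrib, Finset.sum_const, hTd, nsmul_eq_mul, mul_one] at e3
  rw [← Finset.sum_mul] at e4
  simp only [sub_mul, one_mul, Finset.sum_sub_distrib] at e1 e3 ⊢
  nlinarith

lemma vecMulVec_star_isHermitian {n : Type*} (v : n → ℂ) :
    (vecMulVec v (star v))ᴴ = vecMulVec v (star v) := by
  rw [conjTranspose_vecMulVec, star_star]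

lemma exists_orthonormal_eq_sum {n : Type*} [Fintype n] [DecidableEq n] {A : Matrix n n ℂ}
    (hA : A.IsHermitian) :
    ∃ (v : n → n → ℂ) (a : n → ℝ), (∀ i j, star (v i) ⬝ᵥ v j = if i = j then 1 else 0) ∧
      A = ∑ j, a j • vecMulVec (v j) (star (v j)) := by
  refine ⟨fun j => (hA.eigenvectorBasis j).ofLp, hA.eigenvalues, fun i j => ?_, ?_⟩
  · rw [dotProduct_comm, ← EuclideanSpace.inner_eq_star_dotProduct]
    exact orthonormal_iff_ite.mp hA.eigenvectorBasis.orthonormal i j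
  · conv_lhs => rw [hA.spectral_theorem]
    ext p q
    rw [Unitary.conjStarAlgAut_apply, Matrix.mul_apply, Matrix.sum_apply]
    refine Finset.sum_congr rfl fun j _ => ?_
    simp [Matrix.mul_diagonal, vecMulVec_apply, Matrix.star_apply,
      Matrix.IsHermitian.eigenvectorUnitary_apply]
    ring

lemma sum_smul_mul_sum_smul_of_orthonormal {n : Type*} [Fintype n] [DecidableEq n]
    {v : n → n → ℂ} (hv : ∀ i j, star (v i) ⬝ᵥ v j = if i = j then 1 else 0) (b c : n → ℝ) :
    (∑ j, b j • vecMulVec (v j) (star (v j))) * (∑ j, c j • vecMulVec (v j) (star (v j)))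
      = ∑ j, (b j * c j) • vecMulVec (v j) (star (v j)) := by
  rw [Matrix.sum_mul]
  refine Finset.sum_congr rfl fun i _ => ?_
  rw [Matrix.mul_sum, Finset.sum_eq_single i]
  · rw [Matrix.smul_mul, Matrix.mul_smul, vecMulVec_mul_vecMulVec, hv, smul_smul]
    simp
  · intro j _ hj
    rw [Matrix.smul_mul, Matrix.mul_smul, vecMulVec_mul_vecMulVec, hv, if_neg (Ne.symm hj)]
    simp
  · simp

/-- At most `n` rank-one operators grouped into `k` classes are the pullbacks of a diagonal
projective measurement along a single square matrix. -/
lemma exists_conjTranspose_mul_mul_eq_sum {n k : ℕ} (hk : 0 < k) {σ : Type*}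
    (v : σ → Fin n → ℂ) (f : σ → Fin k) (T : Finset σ) (hT : T.card ≤ n) :
    ∃ (X : Matrix (Fin n) (Fin n) ℂ) (D : Fin k → Matrix (Fin n) (Fin n) ℂ), IsProjMeas D ∧
      ∀ i, Xᴴ * D i * X = ∑ s ∈ T, if f s = i then vecMulVec (v s) (star (v s)) else 0 := by
  obtain ⟨e⟩ : Nonempty (T ↪ Fin n) :=
    Function.Embedding.nonempty_of_card_le (by simpa using hT)
  set X : Fin n → Fin n → ℂ := Function.extend e (fun s => star (v s)) 0 with hX
  set c : Fin n → Fin k := Function.extend e (fun s => f s) (fun _ => ⟨0, hk⟩) with hc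
  refine ⟨Matrix.of X, fun i => Matrix.diagonal fun t => if c t = i then 1 else 0,
    ⟨fun i => ⟨?_, ?_⟩, ?_⟩, fun i => ?_⟩
  · rw [Matrix.diagonal_conjTranspose]
    congr 1
    ext t
    by_cases h : c t = i <;> simp [h]
  · rw [Matrix.diagonal_mul_diagonal]
    congr 1
    ext t
    by_cases h : c t = i <;> simp [h]
  · ext p q
    rw [Matrix.sum_apply]
    by_cases h : p = q <;> simp [Matrix.one_apply, h]
  · ext p q
    rw [Matrix.mul_apply, Matrix.sum_apply, ← Finset.sum_coe_sort T]
    refine (Fintype.sum_of_injective e e.injective _ _ (fun t ht => ?_) fun s => ?_).symm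
    · have : X t = 0 := Function.extend_apply' _ _ _ (by simpa using ht)
      simp [this]
    · have h1 : X (e s) = star (v s) := e.injective.extend_apply _ _ _
      have h2 : c (e s) = f s := e.injective.extend_apply _ _ _
      by_cases h : f s = i <;> simp [Matrix.mul_diagonal, h1, h2, h, vecMulVec_apply]

lemma exists_isProjMeas_mul_mul_eq_sum {n k : ℕ} (hk : 0 < k) {σ : Type*}
    (v : σ → Fin n → ℂ) (f : σ → Fin k) (T : Finset σ) (hT : T.card ≤ n) :
    ∃ (P : Fin k → Matrix (Fin n) (Fin n) ℂ) (M : Matrix (Fin n) (Fin n) ℂ),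
      IsProjMeas P ∧ M.PosSemidef ∧
      ∀ i, M * P i * M = ∑ s ∈ T, if f s = i then vecMulVec (v s) (star (v s)) else 0 := by
  obtain ⟨X, D, ⟨hD, hD1⟩, hXD⟩ := exists_conjTranspose_mul_mul_eq_sum hk v f T hT
  obtain ⟨V, M, hV, hM, -, rfl⟩ := exists_isometry_mul_posSemidef X
  refine ⟨fun i => Vᴴ * D i * V, M, ⟨fun i => ⟨?_, ?_⟩, ?_⟩, hM, fun i => ?_⟩
  · simp [(hD i).1, Matrix.mul_assoc]
  · calc Vᴴ * D i * V * (Vᴴ * D i * V) = Vᴴ * D i * (V * Vᴴ) * (D i * V) := by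
          simp only [Matrix.mul_assoc]
      _ = Vᴴ * (D i * D i) * V := by rw [hV]; simp only [Matrix.mul_one, Matrix.mul_assoc]
      _ = _ := by rw [(hD i).2]
  · rw [← Matrix.sum_mul, ← Matrix.mul_sum, hD1, Matrix.mul_one, mul_eq_one_comm.mp hV]
  · rw [← hXD, Matrix.conjTranspose_mul, hM.1.eq]
    simp only [Matrix.mul_assoc]

lemma sum_hsInner_sub_mul_self_le {n k : ℕ} {P R : Fin k → Matrix (Fin n) (Fin n) ℂ}
    {T : Matrix (Fin n) (Fin n) ℂ} (hP : IsProjMeas P) (hT : T.PosSemidef)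
    (hR : ∀ i, T * P i * T = R i) (hR2 : ∀ i, R i * R i = R i)
    (ξ : Matrix (Fin n) (Fin n) ℂ) {c : ℝ} (hc : 0 < c) :
    ∑ i, hsInner ((P i - R i) * ξ) ((P i - R i) * ξ) ≤
      2 * hsInner ((1 - T) * ξ) ((1 - T) * ξ) +
      2 * (c * ∑ i, hsInner ((1 - T) * (R i * ξ)) ((1 - T) * (R i * ξ)) +
        c⁻¹ * hsInner (T * ξ) (T * ξ)) := by
  have hsum : ∀ Y : Matrix (Fin n) (Fin n) ℂ,
      ∑ i, hsInner (P i * Y) (P i * Y) = hsInner Y Y := by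
    intro Y
    simp only [hsInner_proj_mul (hP.1 _).1 (hP.1 _).2]
    rw [← hsInner_sum_right, ← Matrix.sum_mul, hP.2, Matrix.one_mul]
  rw [← hsum ((1 - T) * ξ), ← hsum (T * ξ), Finset.mul_sum, Finset.mul_sum, Finset.mul_sum,
    ← Finset.sum_add_distrib, Finset.mul_sum, ← Finset.sum_add_distrib]
  refine Finset.sum_le_sum fun i _ => ?_
  set Y := P i * (T * ξ) with hY
  have hRY : R i * ξ = T * Y := by rw [hY, ← hR i]; simp only [Matrix.mul_assoc]
  have hRh : (R i)ᴴ = R i := by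
    rw [← hR i]
    simp [hT.1.eq, (hP.1 i).1, Matrix.mul_assoc]
  have hsplit : (P i - R i) * ξ = P i * ((1 - T) * ξ) + (1 - T) * Y := by
    rw [Matrix.sub_mul (P i), hRY, hY]
    simp only [Matrix.sub_mul, Matrix.mul_sub, Matrix.one_mul]
    abel
  have hYY : hsInner Y Y = hsInner (T * Y) (T * Y) := by
    rw [← hRY, hsInner_proj_mul hRh (hR2 i), hRY, hY, hsInner_proj_mul (hP.1 i).1 (hP.1 i).2,
      hsInner_mul_left, hT.1.eq]
  have hW : hsInner ((1 - T) * Y) ((1 - T) * Y) = -2 * hsInner ((1 - T) * (T * Y)) Y := by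
    have h1 : hsInner (T * (T * Y)) Y = hsInner (T * Y) (T * Y) := by
      rw [hsInner_mul_left T (T * Y), hT.1.eq]
    simp only [Matrix.sub_mul, Matrix.one_mul, hsInner_sub_left, hsInner_sub_right, h1, ← hYY,
      hsInner_comm Y (T * Y)]
    ring
  rw [hsplit, hRY]
  have h1 := hsInner_add_self_le (P i * ((1 - T) * ξ)) ((1 - T) * Y)
  have h2 := neg_two_mul_hsInner_le hc ((1 - T) * (T * Y)) Y
  linarith

/-- Any POVM `Q` which is nearly projective in the state `ξ * ξᴴ` is close to a family of
projections of the form `M * P i * M`, with `P` a projective measurement and `M * M` close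
to the identity. -/
lemma exists_isProjMeas_rounding {n k : ℕ} (hk : 0 < k)
    {Q : Fin k → Matrix (Fin n) (Fin n) ℂ} (hQ : IsPOVM Q) (ξ : Matrix (Fin n) (Fin n) ℂ)
    (hξ : hsInner ξ ξ = 1) {ε : ℝ} (hε : 1 - ∑ i, hsInner (Q i * ξ) (Q i * ξ) ≤ ε) :
    ∃ (P : Fin k → Matrix (Fin n) (Fin n) ℂ) (M : Matrix (Fin n) (Fin n) ℂ),
      IsProjMeas P ∧ M.PosSemidef ∧
      (∀ i, M * P i * M * (M * P i * M) = M * P i * M) ∧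
      (∀ Y : Matrix (Fin n) (Fin n) ℂ,
        hsInner ((1 - M * M) * Y) ((1 - M * M) * Y) ≤ hsInner Y Y) ∧
      hsInner ((1 - M * M) * ξ) ((1 - M * M) * ξ) ≤ 4 * ε ∧
      ∑ i, hsInner ((Q i - M * P i * M) * ξ) ((Q i - M * P i * M) * ξ) ≤ 4 * ε := by
  choose v₀ a₀ hv₀ hQa₀ using fun i => exists_orthonormal_eq_sum (hQ.1 i).1
  let v : Fin k × Fin n → Fin n → ℂ := fun s => v₀ s.1 s.2
  let a : Fin k × Fin n → ℝ := fun s => a₀ s.1 s.2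
  let E : Fin k × Fin n → Matrix (Fin n) (Fin n) ℂ := fun s => vecMulVec (v s) (star (v s))
  have hv : ∀ s, star (v s) ⬝ᵥ v s = 1 := fun s => by simp [v, hv₀]
  have hQa : ∀ i, Q i = ∑ j, a (i, j) • E (i, j) := hQa₀
  have hE : ∀ s, (E s)ᴴ = E s := fun s => vecMulVec_star_isHermitian (v s)
  have hE2 : ∀ s, E s * E s = E s := fun s => by
    simp only [E, vecMulVec_mul_vecMulVec, hv, one_smul]
  have hEtr : ∀ s, (E s).trace = 1 := fun s => by
    simp only [E, trace_vecMulVec]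
    rw [dotProduct_comm, hv]
  have haE : ∑ s, a s • E s = 1 := by
    rw [Fintype.sum_prod_type, ← hQ.2]
    exact Finset.sum_congr rfl fun i _ => (hQa i).symm
  have hQv : ∀ s, star (v s) ⬝ᵥ (Q s.1 *ᵥ v s) = a s := by
    rintro ⟨i, j⟩
    simp only [hQa, Matrix.sum_mulVec, dotProduct_sum, Matrix.smul_mulVec, dotProduct_smul, E,
      vecMulVec_mulVec, v, hv₀]
    rw [Finset.sum_eq_single j]
    · simp
    · intro l _ hl
      simp [hl]
    · simp
  have hQv0 : ∀ i s, 0 ≤ star (v s) ⬝ᵥ (Q i *ᵥ v s) := fun i s =>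
    (hQ.1 i).dotProduct_mulVec_nonneg _
  have ha0 : ∀ s, 0 ≤ a s := fun s => by
    have h := hQv0 s.1 s
    rw [hQv] at h
    exact_mod_cast h
  have ha1 : ∀ s, a s ≤ 1 := fun s => by
    have h : (a s : ℂ) ≤ 1 := by
      have hsum : star (v s) ⬝ᵥ (∑ i, Q i) *ᵥ v s = 1 := by rw [hQ.2, Matrix.one_mulVec, hv]
      rw [← hQv, ← hsum, Matrix.sum_mulVec, dotProduct_sum]
      exact Finset.single_le_sum (f := fun i => star (v s) ⬝ᵥ (Q i *ᵥ v s))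
        (fun i _ => hQv0 i s) (Finset.mem_univ s.1)
    exact_mod_cast h
  have hasum : ∑ s, a s = n := by
    have h := congrArg Matrix.trace haE
    simp only [Matrix.trace_sum, Matrix.trace_smul, hEtr, Matrix.trace_one, Fintype.card_fin] at h
    have h' := congrArg Complex.re h
    simpa using h'
  let w : Fin k × Fin n → ℝ := fun s => hsInner (E s * ξ) (E s * ξ)
  have hw : ∀ s, 0 ≤ w s := fun s => hsInner_self_nonneg _
  have haw : ∑ s, a s * w s = 1 := by
    rw [← hsInner_sum_smul_proj_mul hE hE2, haE, Matrix.one_mul, hξ]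
  have haaw : ∑ s, a s * a s * w s = ∑ i, hsInner (Q i * ξ) (Q i * ξ) := by
    rw [Fintype.sum_prod_type]
    refine Finset.sum_congr rfl fun i _ => ?_
    rw [hsInner_mul_left, (hQ.1 i).1.eq, ← Matrix.mul_assoc]
    conv_rhs => rw [hQa₀ i, sum_smul_mul_sum_smul_of_orthonormal (hv₀ i)]
    exact (hsInner_sum_smul_proj_mul (fun j => hE (i, j)) (fun j => hE2 (i, j)) _ _ _).symm
  have hdef : ∑ s, a s * (1 - a s) * w s ≤ ε := by
    simp only [mul_sub, sub_mul, mul_one, Finset.sum_sub_distrib, haw, haaw]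
    exact hε
  obtain ⟨T, hTB, hTn, hTw⟩ := exists_subset_card_le_sum_sdiff_le
    (Finset.univ.filter fun s => 1 / 2 ≤ a s) ha0 ha1 hw (d := n)
    (hasum ▸ Finset.sum_le_sum_of_subset_of_nonneg (Finset.filter_subset _ _) fun s _ _ => ha0 s)
  have hTa : ∀ s ∈ T, 1 / 2 ≤ a s := fun s hs => (Finset.mem_filter.mp (hTB hs)).2
  obtain ⟨P, M, hP, hM, hMP⟩ := exists_isProjMeas_mul_mul_eq_sum hk v Prod.fst T hTn
  let x : Fin k × Fin n → ℝ := fun s => if s ∈ T then 1 else 0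
  let c : Fin k × Fin n → ℝ := fun s => a s - x s
  have hR : ∀ i, M * P i * M = ∑ j, x (i, j) • E (i, j) := by
    intro i
    rw [hMP, ← Finset.univ_inter T, ← Finset.sum_ite_mem, Fintype.sum_prod_type,
      Finset.sum_eq_single i]
    · simp [x, E]
    · intro l _ hl
      simp [hl]
    · simp
  have hca : ∀ s, |c s| ≤ a s := by
    intro s
    by_cases hs : s ∈ T
    · have := hTa s hs
      have := ha1 s
      simp only [c, x, if_pos hs]
      rw [abs_le]
      constructor <;> linarith
    · simp [c, x, hs, abs_of_nonneg (ha0 s)]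
  have hcw : ∑ s, |c s| * w s ≤ 4 * ε := by
    have h1 : ∀ s, |c s| * w s ≤ 2 * (a s * (1 - a s) * w s) +
        if s ∈ (Finset.univ.filter fun s => 1 / 2 ≤ a s) \ T then w s else 0 := by
      intro s
      have h0 := ha0 s
      have h1 := ha1 s
      have hws := hw s
      have hp : 0 ≤ a s * (1 - a s) * w s :=
        mul_nonneg (mul_nonneg h0 (sub_nonneg.mpr h1)) hws
      by_cases hs : s ∈ T
      · have h2 := hTa s hs
        have h3 : |c s| = 1 - a s := by
          simp only [c, x, if_pos hs]
          rw [abs_sub_comm, abs_of_nonneg (by linarith)]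
        rw [h3, if_neg (by simp [hs]), add_zero, ← mul_assoc]
        exact mul_le_mul_of_nonneg_right (by nlinarith) hws
      · have h3 : |c s| = a s := by simp [c, x, hs, abs_of_nonneg h0]
        rw [h3]
        by_cases h2 : 1 / 2 ≤ a s
        · rw [if_pos (by simp [hs]; linarith)]
          nlinarith
        · rw [if_neg (by simp [hs]; linarith), add_zero, ← mul_assoc]
          exact mul_le_mul_of_nonneg_right (by nlinarith) hws
    have h2 : ∑ s ∈ Finset.univ.filter (fun s => 1 / 2 ≤ a s), (1 - a s) * w s
        ≤ ∑ s, 2 * (a s * (1 - a s) * w s) := by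
      refine (Finset.sum_le_sum fun s hs => ?_).trans
        (Finset.sum_le_sum_of_subset_of_nonneg (Finset.filter_subset _ _) fun s _ _ => ?_)
      · have h := (Finset.mem_filter.mp hs).2
        have h1 := ha1 s
        rw [← mul_assoc]
        exact mul_le_mul_of_nonneg_right (by nlinarith) (hw s)
      · exact mul_nonneg two_pos.le
          (mul_nonneg (mul_nonneg (ha0 s) (sub_nonneg.mpr (ha1 s))) (hw s))
    have h3 := Finset.sum_le_sum fun s (_ : s ∈ Finset.univ) => h1 s
    rw [Finset.sum_add_distrib, Finset.sum_ite_mem, Finset.univ_inter] at h3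
    rw [← Finset.mul_sum] at h2 h3
    linarith
  have hMM : 1 - M * M = ∑ s, c s • E s := by
    have h : M * M = ∑ i, M * P i * M := by
      rw [← Finset.sum_mul, ← Finset.mul_sum, hP.2, Matrix.mul_one]
    simp only [c, sub_smul, Finset.sum_sub_distrib, haE]
    rw [h, Fintype.sum_prod_type]
    simp only [hR]
  refine ⟨P, M, hP, hM, fun i => ?_, fun Y => ?_, ?_, ?_⟩
  · rw [hR]
    refine (sum_smul_mul_sum_smul_of_orthonormal (hv₀ i) _ _).trans
      (Finset.sum_congr rfl fun j _ => ?_)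
    by_cases h : (i, j) ∈ T <;> simp [x, h, E, v]
  · rw [hMM]
    refine (hsInner_sum_smul_proj_mul_le hE hE2 hca haE Y).trans ?_
    have hY : hsInner Y Y = ∑ s, a s * hsInner (E s * Y) (E s * Y) := by
      rw [← hsInner_sum_smul_proj_mul hE hE2, haE, Matrix.one_mul]
    rw [hY]
    exact Finset.sum_le_sum fun s _ =>
      mul_le_mul_of_nonneg_right (hca s) (hsInner_self_nonneg _)
  · rw [hMM]
    exact (hsInner_sum_smul_proj_mul_le hE hE2 hca haE ξ).trans hcw
  · refine le_trans ?_ hcw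
    rw [Fintype.sum_prod_type]
    refine Finset.sum_le_sum fun i _ => ?_
    have h : Q i - M * P i * M = ∑ s, (if s.1 = i then c s else 0) • E s := by
      rw [hR, hQa, ← Finset.sum_sub_distrib, Fintype.sum_prod_type, Finset.sum_eq_single i]
      · simp [c, sub_smul]
      · intro l _ hl
        simp [hl]
      · simp
    rw [h]
    refine (hsInner_sum_smul_proj_mul_le hE hE2 (fun s => ?_) haE ξ).trans (le_of_eq ?_)
    · split_ifs
      · exact hca s
      · simpa using ha0 s
    · rw [Fintype.sum_prod_type, Finset.sum_eq_single i]
      · simp [w]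
      · intro l _ hl
        simp [hl]
      · simp

lemma hsInner_mul_mul_self_le {m n : Type*} [Fintype m] [DecidableEq m] [Fintype n]
    {A : Matrix m m ℂ} (hA : A.PosSemidef) (hA1 : (1 - A).PosSemidef) (X : Matrix m n ℂ) :
    hsInner (A * X) (A * X) ≤ hsInner X (A * X) := by
  have h1 := hsInner_mul_nonneg hA1 (A * X)
  have h2 := hsInner_mul_nonneg hA ((1 - A) * X)
  have h3 : hsInner X (A * (A * X)) = hsInner (A * X) (A * X) := by
    rw [hsInner_mul_left, hA.1.eq]
  simp only [Matrix.sub_mul, Matrix.mul_sub, Matrix.one_mul, hsInner_sub_left,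
    hsInner_sub_right, h3] at h1 h2
  linarith

lemma IsPOVM.one_sub_posSemidef {n 𝒜 : Type*} [Fintype n] [DecidableEq n] [Fintype 𝒜]
    {Q : 𝒜 → Matrix n n ℂ} (hQ : IsPOVM Q) (i : 𝒜) : (1 - Q i).PosSemidef := by
  classical
  rw [← hQ.2, ← Finset.add_sum_erase _ Q (Finset.mem_univ i), add_sub_cancel_left]
  exact Matrix.posSemidef_sum _ fun j _ => hQ.1 j

/-- The correlation of `Q` with itself through a Hermitian `ξ` controls the distance to a
projective measurement. -/
lemma exists_isProjMeas_sum_hsInner_le {n k : ℕ} (hk : 0 < k)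
    {Q : Fin k → Matrix (Fin n) (Fin n) ℂ} (hQ : IsPOVM Q) {ξ : Matrix (Fin n) (Fin n) ℂ}
    (hξh : ξᴴ = ξ) (hξ : hsInner ξ ξ = 1) {δ : ℝ}
    (hδ : δ = 1 - ∑ i, hsInner (Q i * ξ) (ξ * Q i)) :
    ∃ P : Fin k → Matrix (Fin n) (Fin n) ℂ, IsProjMeas P ∧
      ∀ c : ℝ, 0 < c → ∑ i, hsInner ((P i - Q i) * ξ) ((P i - Q i) * ξ)
        ≤ 24 * δ + 4 * (c * (88 * δ) + c⁻¹ * 2) := by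
  have hQh : ∀ i, (Q i)ᴴ = Q i := fun i => (hQ.1 i).1.eq
  have hswap : ∀ A : Matrix (Fin n) (Fin n) ℂ, Aᴴ = A →
      hsInner (ξ * A) (ξ * A) = hsInner (A * ξ) (A * ξ) := by
    intro A hA
    rw [← hsInner_conjTranspose, Matrix.conjTranspose_mul, hA, hξh]
  have hcomm : ∀ i, hsInner (Q i * ξ - ξ * Q i) (Q i * ξ - ξ * Q i)
      = 2 * hsInner (Q i * ξ) (Q i * ξ) - 2 * hsInner (Q i * ξ) (ξ * Q i) := by
    intro i
    simp only [hsInner_sub_left, hsInner_sub_right, hswap _ (hQh i),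
      hsInner_comm (ξ * Q i) (Q i * ξ)]
    ring
  have hcomm_sum : ∑ i, hsInner (Q i * ξ - ξ * Q i) (Q i * ξ - ξ * Q i)
      = 2 * ∑ i, hsInner (Q i * ξ) (Q i * ξ) - 2 * (1 - δ) := by
    simp only [hcomm, Finset.sum_sub_distrib, ← Finset.mul_sum, hδ]
    ring
  have hε : 1 - ∑ i, hsInner (Q i * ξ) (Q i * ξ) ≤ δ := by
    have h := Finset.sum_nonneg fun i (_ : i ∈ Finset.univ) =>
      hsInner_self_nonneg (Q i * ξ - ξ * Q i)
    linarith
  have hQ1 : ∑ i, hsInner (Q i * ξ) (Q i * ξ) ≤ 1 := by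
    refine (Finset.sum_le_sum fun i _ =>
      hsInner_mul_mul_self_le (hQ.1 i) (hQ.one_sub_posSemidef i) ξ).trans (le_of_eq ?_)
    rw [← hsInner_sum_right, ← Matrix.sum_mul, hQ.2, Matrix.one_mul, hξ]
  obtain ⟨P, M, hP, hM, hR2, hMY, hMξ, hQR⟩ := exists_isProjMeas_rounding hk hQ ξ hξ hε
  refine ⟨P, hP, fun c hc => ?_⟩
  obtain ⟨R, hR⟩ : ∃ R : Fin k → Matrix (Fin n) (Fin n) ℂ, ∀ i, M * P i * M = R i :=
    ⟨_, fun _ => rfl⟩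
  simp only [hR] at hR2 hQR
  have hRh : ∀ i, (R i)ᴴ = R i := fun i => by
    rw [← hR]
    simp [hM.1.eq, (hP.1 i).1, Matrix.mul_assoc]
  have hRsum : ∑ i, R i = M * M := by
    simp only [← hR]
    rw [← Finset.sum_mul, ← Finset.mul_sum, hP.2, Matrix.mul_one]
  have hMM : ∀ Y : Matrix (Fin n) (Fin n) ℂ, hsInner Y (M * M * Y) ≤ 2 * hsInner Y Y := by
    intro Y
    have h1 := neg_two_mul_hsInner_le one_pos Y ((1 - M * M) * Y)
    have h2 := hMY Y
    rw [Matrix.sub_mul, Matrix.one_mul, hsInner_sub_right] at h1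
    rw [Matrix.sub_mul, Matrix.one_mul] at h2
    linarith
  have hRY : ∀ Y : Matrix (Fin n) (Fin n) ℂ,
      ∑ i, hsInner (Y * R i) (Y * R i) ≤ 2 * hsInner Y Y := by
    intro Y
    have h : ∀ i, hsInner (Y * R i) (Y * R i) = hsInner Yᴴ (R i * Yᴴ) := by
      intro i
      rw [← hsInner_conjTranspose, Matrix.conjTranspose_mul, hRh,
        hsInner_proj_mul (hRh i) (hR2 i)]
    simp only [h]
    rw [← hsInner_sum_right, ← Matrix.sum_mul, hRsum, ← hsInner_conjTranspose Y Y]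
    exact hMM _
  have hMle : ∀ Y : Matrix (Fin n) (Fin n) ℂ,
      hsInner ((1 - M) * Y) ((1 - M) * Y) ≤ hsInner Y Y := fun Y =>
    (hsInner_one_sub_mul_le hM Y).trans (hMY Y)
  have hMξ' : hsInner ((1 - M) * ξ) ((1 - M) * ξ) ≤ 4 * δ :=
    (hsInner_one_sub_mul_le hM ξ).trans hMξ
  have hRcomm : ∑ i, hsInner (R i * ξ - ξ * R i) (R i * ξ - ξ * R i) ≤ 36 * δ := by
    have h : ∀ i, hsInner (R i * ξ - ξ * R i) (R i * ξ - ξ * R i) ≤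
        2 * hsInner (Q i * ξ - ξ * Q i) (Q i * ξ - ξ * Q i) +
        8 * hsInner ((Q i - R i) * ξ) ((Q i - R i) * ξ) := by
      intro i
      have e : R i * ξ - ξ * R i
          = (Q i * ξ - ξ * Q i) - ((Q i - R i) * ξ - ξ * (Q i - R i)) := by
        simp only [Matrix.sub_mul, Matrix.mul_sub]
        abel
      have h1 := hsInner_sub_self_le (Q i * ξ - ξ * Q i) ((Q i - R i) * ξ - ξ * (Q i - R i))
      have h2 := hsInner_sub_self_le ((Q i - R i) * ξ) (ξ * (Q i - R i))
      rw [hswap _ (by rw [Matrix.conjTranspose_sub, hQh, hRh])] at h2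
      rw [e]
      linarith
    have h' := Finset.sum_le_sum fun i (_ : i ∈ Finset.univ) => h i
    rw [Finset.sum_add_distrib, ← Finset.mul_sum, ← Finset.mul_sum, hcomm_sum] at h'
    linarith
  have hMR : ∑ i, hsInner ((1 - M) * (R i * ξ)) ((1 - M) * (R i * ξ)) ≤ 88 * δ := by
    have h : ∀ i, hsInner ((1 - M) * (R i * ξ)) ((1 - M) * (R i * ξ)) ≤
        2 * hsInner ((1 - M) * ξ * R i) ((1 - M) * ξ * R i) +
        2 * hsInner (R i * ξ - ξ * R i) (R i * ξ - ξ * R i) := by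
      intro i
      have e : (1 - M) * (R i * ξ)
          = (1 - M) * ξ * R i + (1 - M) * (R i * ξ - ξ * R i) := by
        rw [Matrix.mul_assoc, ← Matrix.mul_add, add_sub_cancel]
      have h1 := hsInner_add_self_le ((1 - M) * ξ * R i) ((1 - M) * (R i * ξ - ξ * R i))
      have h2 := hMle (R i * ξ - ξ * R i)
      rw [e]
      linarith
    have h' := Finset.sum_le_sum fun i (_ : i ∈ Finset.univ) => h i
    rw [Finset.sum_add_distrib, ← Finset.mul_sum, ← Finset.mul_sum] at h'
    have := hRY ((1 - M) * ξ)
    linarith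
  have hTξ : hsInner (M * ξ) (M * ξ) ≤ 2 := by
    rw [hsInner_mul_left, hM.1.eq, ← Matrix.mul_assoc]
    have := hMM ξ
    linarith
  have hPR := sum_hsInner_sub_mul_self_le hP hM hR hR2 ξ hc
  have hfin : ∀ i, hsInner ((P i - Q i) * ξ) ((P i - Q i) * ξ) ≤
      2 * hsInner ((P i - R i) * ξ) ((P i - R i) * ξ) +
      2 * hsInner ((Q i - R i) * ξ) ((Q i - R i) * ξ) := by
    intro i
    have e : (P i - Q i) * ξ = (P i - R i) * ξ - (Q i - R i) * ξ := by
      rw [← Matrix.sub_mul, sub_sub_sub_cancel_right]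
    rw [e]
    exact hsInner_sub_self_le _ _
  have h' := Finset.sum_le_sum fun i (_ : i ∈ Finset.univ) => hfin i
  rw [Finset.sum_add_distrib, ← Finset.mul_sum, ← Finset.mul_sum] at h'
  have hc1 := mul_le_mul_of_nonneg_left hMR hc.le
  have hc2 := mul_le_mul_of_nonneg_left hTξ (inv_pos.mpr hc).le
  linarith

lemma ev_canonPsi_kronecker_transpose {n : Type*} [Fintype n] [DecidableEq n] (lam : n → ℝ)
    (A B : Matrix n n ℂ) :
    ev (canonPsi lam) (A ⊗ₖ Bᵀ) =
      (A * diagonal (fun i => (Real.sqrt (lam i) : ℂ)) *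
        (B * diagonal fun i => (Real.sqrt (lam i) : ℂ))).trace.re := by
  rw [ev]
  congr 1
  simp only [dotProduct, Matrix.mulVec, Pi.star_apply, Fintype.sum_prod_type, canonPsi, Matrix.kroneckerMap_apply,
    Matrix.trace, Matrix.diag_apply, Matrix.mul_apply (M := _ * _), Matrix.mul_diagonal]
  simp only [mul_ite, mul_zero, Finset.sum_ite_eq, Finset.mem_univ, if_true,
    apply_ite star, star_zero, ite_mul, zero_mul, Matrix.transpose_apply]
  refine Finset.sum_congr rfl fun i _ => ?_
  simp only [Finset.mul_sum, RCLike.star_def, Complex.conj_ofReal]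
  exact Finset.sum_congr rfl fun j _ => by ring

lemma le_mul_sqrt_of_forall_pos {x a b δ : ℝ} (hδ : 0 ≤ δ)
    (h : ∀ c : ℝ, 0 < c → x ≤ c * (a * δ) + c⁻¹ * b) : x ≤ (a + b) * Real.sqrt δ := by
  rcases hδ.eq_or_lt with rfl | hδ
  · rw [Real.sqrt_zero, mul_zero]
    have ht : Filter.Tendsto (fun c : ℝ => c⁻¹ * b) Filter.atTop (nhds (0 * b)) :=
      tendsto_inv_atTop_zero.mul_const b
    rw [zero_mul] at ht
    refine ge_of_tendsto ht ((Filter.eventually_gt_atTop 0).mono fun c hc => ?_)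
    simpa using h c hc
  · have hs := Real.sqrt_pos.mpr hδ
    refine (h _ (inv_pos.mpr hs)).trans (le_of_eq ?_)
    rw [inv_inv]
    nth_rewrite 2 [← Real.mul_self_sqrt hδ.le]
    field_simp

theorem stmt5 :
    ∃ K : ℝ, 0 < K ∧
    ∀ (n k : ℕ) (_hk : 0 < k)
      (lam : Fin n → ℝ) (_hlam : ∀ i, 0 ≤ lam i) (_hlam1 : ∑ i, lam i = 1)
      (Q : Fin k → Matrix (Fin n) (Fin n) ℂ) (_hQ : IsPOVM Q)
      (δ : ℝ) (_hδ0 : 0 ≤ δ) (_hδ1 : δ ≤ 1)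
      (_hδ : δ = 1 - ∑ i, ev (canonPsi lam) (Q i ⊗ₖ (Q i)ᵀ)),
      ∃ P : Fin k → Matrix (Fin n) (Fin n) ℂ, IsProjMeas P ∧
        ∑ i, ev (canonPsi lam)
            (((P i - Q i) * (P i - Q i)) ⊗ₖ (1 : Matrix (Fin n) (Fin n) ℂ))
          ≤ K * δ ^ ((1:ℝ)/4) := by

  refine ⟨540, by norm_num, ?_⟩
  intro n k hk lam hlam hlam1 Q hQ δ hδ0 hδ1 hδ
  set ξ : Matrix (Fin n) (Fin n) ℂ := diagonal fun i => (Real.sqrt (lam i) : ℂ) with hξdef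
  have hξh : ξᴴ = ξ := by
    rw [hξdef, Matrix.diagonal_conjTranspose]
    congr 1
    ext i
    simp
  have hξ : hsInner ξ ξ = 1 := by
    rw [hsInner, hξh, hξdef, Matrix.diagonal_mul_diagonal, Matrix.trace_diagonal, Complex.re_sum,
      ← hlam1]
    refine Finset.sum_congr rfl fun i _ => ?_
    rw [← Complex.ofReal_mul, Complex.ofReal_re, Real.mul_self_sqrt (hlam i)]
  have hev : ∀ i, ev (canonPsi lam) (Q i ⊗ₖ (Q i)ᵀ) = hsInner (Q i * ξ) (ξ * Q i) := by
    intro i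
    rw [ev_canonPsi_kronecker_transpose, hsInner, Matrix.conjTranspose_mul, hξh,
      (hQ.1 i).1.eq, ← hξdef, Matrix.trace_mul_comm]
    simp only [Matrix.mul_assoc]
    rw [Matrix.trace_mul_comm]
    simp only [Matrix.mul_assoc]
  simp only [hev] at hδ
  obtain ⟨P, hP, hPQ⟩ := exists_isProjMeas_sum_hsInner_le hk hQ hξh hξ hδ
  refine ⟨P, hP, ?_⟩
  have hev' : ∀ i, ev (canonPsi lam)
      (((P i - Q i) * (P i - Q i)) ⊗ₖ (1 : Matrix (Fin n) (Fin n) ℂ))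
      = hsInner ((P i - Q i) * ξ) ((P i - Q i) * ξ) := by
    intro i
    rw [← Matrix.transpose_one, ev_canonPsi_kronecker_transpose, hsInner,
      Matrix.conjTranspose_mul, hξh, Matrix.conjTranspose_sub, (hP.1 i).1, (hQ.1 i).1.eq,
      ← hξdef, Matrix.one_mul, Matrix.trace_mul_comm]
    simp only [Matrix.mul_assoc]
  simp only [hev']
  have h1 : ∑ i, hsInner ((P i - Q i) * ξ) ((P i - Q i) * ξ) - 24 * δ
      ≤ (352 + 8) * Real.sqrt δ :=
    le_mul_sqrt_of_forall_pos hδ0 fun c hc => by linarith [hPQ c hc]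
  have h2 : Real.sqrt δ ≤ δ ^ ((1 : ℝ) / 4) := by
    rw [Real.sqrt_eq_rpow]
    exact Real.rpow_le_rpow_of_exponent_ge_of_imp hδ0 hδ1 (by norm_num) (by norm_num)
  have h3 : δ ≤ Real.sqrt δ := Real.le_sqrt_of_sq_le (by nlinarith)
  have h4 := Real.sqrt_nonneg δ
  linarith

end AlmostSync
end

section
/- There are universal constants c, C > 0 such that the following holds. Let 𝒳 and 𝒜 be finite sets, ν a distribution on 𝒳, 𝒮 = (|ψ⟩, A) a symmetric strategy on H ⊗ H, and δ = δ_sync(𝒮; ν). Let ρ be the reduced density of |ψ⟩ on H, for λ ∈ ℝ_+ let P_λ = χ_{≥λ}(ρ) be the spectral projection of ρ onto eigenvalues ≥ λ, let H_λ = range(P_λ), let ρ_λ = P_λ / Tr(P_λ) be the totally mixed state on H_λ, and let dμ(λ) = Tr(P_λ) dλ, which is a probability measure on ℝ_+. Then ρ = ∫_0^∞ P_λ dλ, and for every λ there exists for each x ∈ 𝒳 a projective measurement {A^{λ,x}_a}_{a∈𝒜} supported on H_λ such that E_{x∼ν} Σ_a ∫_0^∞ Tr((A^x_a − A^{λ,x}_a)²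 ρ_λ) dμ(λ) ≤ C δ^c. -/
open scoped Kronecker ComplexOrder
open Matrix MeasureTheory

attribute [local instance] Matrix.normedAddCommGroup Matrix.normedSpace

namespace AlmostSync

open Module in
/-- Polar rounding: a family of vectors that is a sub-frame with bound one is close to an
orthonormal basis. -/
lemma exists_orthonormalBasis_sum_sq_norm_le {E κ : Type*} [NormedAddCommGroup E]
    [InnerProductSpace ℂ E] [FiniteDimensional ℂ E] [Fintype κ]
    (hκ : finrank ℂ E = Fintype.card κ) (w : κ → E)
    (hw : ∀ h, ∑ k, ‖inner ℂ (w k) h‖ ^ 2 ≤ ‖h‖ ^ 2) :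
    ∃ e : OrthonormalBasis κ ℂ E, ∑ k, ‖w k‖ ^ 2 ≤ ∑ k, (inner ℂ (w k) (e k)).re := by
  classical
  let T : E →ₗ[ℂ] EuclideanSpace ℂ κ :=
    { toFun := fun h => WithLp.toLp 2 fun k => inner ℂ (w k) h
      map_add' := fun x y => by ext k; simp
      map_smul' := fun c x => by ext k; simp }
  have hT (h : E) (k : κ) : T h k = inner ℂ (w k) h := rfl
  have hTn (h : E) : ‖T h‖ ^ 2 = ∑ k, ‖inner ℂ (w k) h‖ ^ 2 := by
    simp [EuclideanSpace.norm_sq_eq, hT]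
  have hsym : (LinearMap.adjoint T ∘ₗ T).IsSymmetric := T.isSymmetric_adjoint_comp_self
  let v := hsym.eigenvectorBasis hκ
  have horth (i j) (hij : i ≠ j) : inner ℂ (T (v i)) (T (v j)) = 0 := by
    rw [← LinearMap.adjoint_inner_right, ← LinearMap.comp_apply,
      hsym.apply_eigenvectorBasis, inner_smul_right, v.orthonormal.2 hij, mul_zero]
  let y : Fin (Fintype.card κ) → EuclideanSpace ℂ κ := fun i => ((‖T (v i)‖⁻¹ : ℝ) : ℂ) • T (v i)
  have hy : Orthonormal ℂ (Set.domRestrict {i | T (v i) ≠ 0} y) := by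
    refine ⟨fun i => ?_, fun i j hij => ?_⟩
    · have : ‖T (v i)‖ ≠ 0 := norm_ne_zero_iff.2 i.2
      simp [y, norm_smul, this]
    · have : (i : Fin (Fintype.card κ)) ≠ j := fun h => hij (Subtype.ext h)
      simp [y, inner_smul_left, inner_smul_right, horth _ _ this]
  obtain ⟨u, hu⟩ := hy.exists_orthonormalBasis_extension_of_card_eq (by simp)
  let U : E ≃ₗᵢ[ℂ] EuclideanSpace ℂ κ := v.equiv u (Equiv.refl _)
  have hU (i) : U.symm (u i) = v i := by
    rw [LinearIsometryEquiv.symm_apply_eq]; simp [U]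
  have huT (i) : inner ℂ (u i) (T (v i)) = (‖T (v i)‖ : ℂ) := by
    by_cases h : T (v i) = 0
    · simp [h]
    · have : (‖T (v i)‖ : ℂ) ≠ 0 :=
        Complex.ofReal_ne_zero.2 (norm_ne_zero_iff.2 h)
      rw [hu i h]
      simp only [y, inner_smul_left, inner_self_eq_norm_sq_to_K]
      simp; field_simp
  let b := EuclideanSpace.basisFun κ ℂ
  refine ⟨b.map U.symm, ?_⟩
  have h1 : ∑ k, inner ℂ (w k) (b.map U.symm k) = ∑ i, (‖T (v i)‖ : ℂ) := by
    trans LinearMap.trace ℂ (EuclideanSpace ℂ κ) (T ∘ₗ U.symm.toLinearEquiv.toLinearMap)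
    · rw [LinearMap.trace_eq_sum_inner _ b]
      refine Finset.sum_congr rfl fun k _ => ?_
      simp [b, ← hT, EuclideanSpace.inner_single_left]
    · rw [LinearMap.trace_eq_sum_inner _ u]
      refine Finset.sum_congr rfl fun i _ => ?_
      simp [hU, huT]
  have h2 : ∑ k, ‖w k‖ ^ 2 = ∑ i, ‖T (v i)‖ ^ 2 := by
    simp_rw [hTn]
    rw [Finset.sum_comm]
    exact Finset.sum_congr rfl fun k _ => (v.sum_sq_norm_inner_left (w k)).symm
  have h3 (i) : ‖T (v i)‖ ≤ 1 := by
    have := (hTn (v i)).trans_le (hw (v i))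
    rw [v.orthonormal.1 i] at this
    nlinarith [norm_nonneg (T (v i))]
  rw [← Complex.re_sum, h1, h2, ← Complex.ofReal_sum, Complex.ofReal_re]
  exact Finset.sum_le_sum fun i _ => by nlinarith [h3 i, norm_nonneg (T (v i))]

/-- Weights in `[0, 1]` of total mass `m` have `m` entries that carry at least the sum of their
squares. -/
lemma exists_finset_sum_sq_le {ι : Type*} [Fintype ι] (x : ι → ℝ) (h0 : ∀ i, 0 ≤ x i)
    (h1 : ∀ i, x i ≤ 1) (m : ℕ) (hx : ∑ i, x i = m) :
    ∃ S : Finset ι, S.card = m ∧ ∑ i, x i ^ 2 ≤ ∑ i ∈ S, x i := by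
  classical
  have hm : m ≤ (Finset.univ : Finset ι).card := by
    have : ∑ i, x i ≤ ∑ _i : ι, (1 : ℝ) := Finset.sum_le_sum fun i _ => h1 i
    rw [hx] at this
    simpa using this
  obtain ⟨S, hS, hmax⟩ := Finset.exists_max_image (Finset.powersetCard m Finset.univ)
    (fun S => ∑ i ∈ S, x i) (Finset.powersetCard_nonempty.2 hm)
  rw [Finset.mem_powersetCard] at hS
  refine ⟨S, hS.2, ?_⟩
  have hswap (k) (hk : k ∈ S) (l) (hl : l ∉ S) : x l ≤ x k := by
    have hl' : l ∉ S.erase k := fun h => hl (Finset.mem_of_mem_erase h)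
    have := hmax (insert l (S.erase k)) (by
      rw [Finset.mem_powersetCard, Finset.card_insert_of_notMem hl',
        Finset.card_erase_add_one hk]
      exact ⟨Finset.subset_univ _, hS.2⟩)
    rw [Finset.sum_insert hl', ← Finset.add_sum_erase _ _ hk] at this
    linarith
  obtain ⟨θ, hin, hout⟩ : ∃ θ : ℝ, (∀ k ∈ S, θ ≤ x k) ∧ ∀ l ∉ S, x l ≤ θ := by
    rcases S.eq_empty_or_nonempty with rfl | hne
    · exact ⟨1, by simp, fun l _ => h1 l⟩
    · obtain ⟨k, hk, hmin⟩ := Finset.exists_min_image S x hne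
      exact ⟨x k, hmin, fun l hl => hswap k hk l hl⟩
  have e1 : ∑ i ∈ S, θ * (1 - x i) ≤ ∑ i ∈ S, (x i - x i ^ 2) :=
    Finset.sum_le_sum fun i hi => by nlinarith [hin i hi, h1 i]
  have e2 : ∑ i ∈ Sᶜ, x i ^ 2 ≤ ∑ i ∈ Sᶜ, θ * x i :=
    Finset.sum_le_sum fun i hi => by nlinarith [hout i (Finset.mem_compl.1 hi), h0 i]
  rw [← Finset.mul_sum] at e1 e2
  rw [← Finset.sum_add_sum_compl S] at hx ⊢
  simp only [Finset.sum_sub_distrib, Finset.sum_const, hS.2, nsmul_eq_mul, mul_one] at e1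
  have e3 : ∑ i ∈ Sᶜ, x i = m - ∑ i ∈ S, x i := by linarith
  rw [e3] at e2
  linarith

open Module in
lemma exists_orthonormalBasis_of_parseval {E ι : Type*} [NormedAddCommGroup E]
    [InnerProductSpace ℂ E] [FiniteDimensional ℂ E] [Fintype ι] (w : ι → E)
    (hw : ∀ h, ∑ k, ‖inner ℂ (w k) h‖ ^ 2 = ‖h‖ ^ 2) :
    ∃ (S : Finset ι) (e : OrthonormalBasis S ℂ E),
      2 * ∑ k, ‖w k‖ ^ 4 - finrank ℂ E ≤ ∑ k : S, ‖inner ℂ (w k) (e k)‖ ^ 2 := by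
  have hle (k) : ‖w k‖ ^ 2 ≤ 1 := by
    have h := (Finset.single_le_sum (f := fun l => ‖inner ℂ (w l) (w k)‖ ^ 2)
      (fun l _ => sq_nonneg _) (Finset.mem_univ k)).trans_eq (hw (w k))
    have h' : ‖inner ℂ (w k) (w k)‖ = ‖w k‖ ^ 2 := by
      rw [inner_self_eq_norm_sq_to_K]; simp
    simp only [h'] at h
    by_contra! hc
    nlinarith
  have htot : ∑ k, ‖w k‖ ^ 2 = (finrank ℂ E : ℕ) := by
    let b := stdOrthonormalBasis ℂ E
    calc ∑ k, ‖w k‖ ^ 2 = ∑ k, ∑ i, ‖inner ℂ (w k) (b i)‖ ^ 2 :=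
          Finset.sum_congr rfl fun k _ => (b.sum_sq_norm_inner_left (w k)).symm
      _ = _ := by
          rw [Finset.sum_comm]
          simp [hw, b.orthonormal.1]
  obtain ⟨S, hS, hsum⟩ := exists_finset_sum_sq_le (fun k => ‖w k‖ ^ 2) (fun k => sq_nonneg _)
    hle _ htot
  obtain ⟨e, he⟩ := exists_orthonormalBasis_sum_sq_norm_le (κ := S) (by simp [hS])
    (fun k => w k) (fun h => by
      rw [Finset.sum_coe_sort S (fun k => ‖inner ℂ (w k) h‖ ^ 2), ← hw h]
      exact Finset.sum_le_sum_of_subset_of_nonneg (Finset.subset_univ _)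
        fun _ _ _ => sq_nonneg _)
  refine ⟨S, e, ?_⟩
  have h1 : ∑ k : S, (2 * (inner ℂ (w k) (e k)).re - 1) ≤
      ∑ k : S, ‖inner ℂ (w k) (e k)‖ ^ 2 := by
    refine Finset.sum_le_sum fun k _ => ?_
    have := Complex.re_le_norm (inner ℂ (w k) (e k))
    nlinarith [sq_nonneg (‖inner ℂ (w k) (e k)‖ - 1)]
  rw [Finset.sum_coe_sort S (fun k => ‖w k‖ ^ 2)] at he
  simp only [← pow_mul] at hsum
  simp only [Finset.sum_sub_distrib, ← Finset.mul_sum, Finset.sum_const, Finset.card_univ,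
    Fintype.card_coe, hS, nsmul_eq_mul, mul_one] at h1
  norm_num at hsum
  linarith

lemma sum_normSq_eq_trace {m n : Type*} [Fintype m] [Fintype n] (X : Matrix m n ℂ) :
    ∑ i, ∑ j, Complex.normSq (X i j) = (X * Xᴴ).trace.re := by
  simp [Matrix.trace, Matrix.mul_apply, Complex.mul_conj, -Complex.mul_re]

/-- A positive semidefinite matrix is a sum of rank one terms along pairwise orthogonal vectors. -/
lemma exists_orthogonal_decomposition {m : Type*} [Fintype m] [DecidableEq m]
    {B : Matrix m m ℂ} (hB : B.PosSemidef) :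
    ∃ w : m → EuclideanSpace ℂ m,
      (∀ h : EuclideanSpace ℂ m, (star h.ofLp ⬝ᵥ B *ᵥ h.ofLp).re = ∑ i, ‖inner ℂ (w i) h‖ ^ 2) ∧
      ∑ i, ‖w i‖ ^ 4 = ∑ i, ∑ j, Complex.normSq (B i j) := by
  have hH := hB.isHermitian
  set v := hH.eigenvectorBasis
  set l := hH.eigenvalues
  let T := Matrix.toLpLin 2 2 B
  have hTs : T.IsSymmetric := Matrix.isSymmetric_toEuclideanLin_iff.2 hH
  have hTv (i) : T (v i) = (l i : ℂ) • v i := by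
    apply (WithLp.equiv 2 _).injective
    simpa [T, Matrix.toLpLin_apply] using hH.mulVec_eigenvectorBasis i
  have hl (i) : 0 ≤ l i := hB.eigenvalues_nonneg i
  have hin (i h) : inner ℂ (v i) (T h) = l i * inner ℂ (v i) h := by
    rw [← hTs, hTv, inner_smul_left, Complex.conj_ofReal]
  refine ⟨fun i => (Real.sqrt (l i) : ℂ) • v i, fun h => ?_, ?_⟩
  · have h1 : star h.ofLp ⬝ᵥ B *ᵥ h.ofLp = inner ℂ h (T h) := by
      rw [EuclideanSpace.inner_eq_star_dotProduct, dotProduct_comm]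
      simp [T, Matrix.toLpLin_apply]
    rw [h1, ← v.sum_inner_mul_inner, Complex.re_sum]
    refine Finset.sum_congr rfl fun i _ => ?_
    rw [hin, inner_smul_left, norm_mul, mul_pow, Complex.conj_ofReal, Complex.norm_real,
      Real.norm_eq_abs, sq_abs, Real.sq_sqrt (hl i), ← inner_conj_symm h (v i), mul_left_comm,
      ← Complex.normSq_eq_conj_mul_self, ← Complex.ofReal_mul, Complex.ofReal_re,
      Complex.normSq_eq_norm_sq]
  · have h2 : ∑ i, ∑ j, Complex.normSq (B i j) =
        ∑ j, ‖T (EuclideanSpace.basisFun m ℂ j)‖ ^ 2 := by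
      rw [Finset.sum_comm]
      simp [T, EuclideanSpace.norm_sq_eq, Complex.normSq_eq_norm_sq]
    simp_rw [h2, ← v.sum_sq_norm_inner_right, hin, norm_mul, mul_pow]
    rw [Finset.sum_comm]
    refine Finset.sum_congr rfl fun i _ => ?_
    rw [← Finset.mul_sum, OrthonormalBasis.sum_sq_norm_inner_left, norm_smul, v.orthonormal.1,
      Complex.norm_real, Complex.norm_real, Real.norm_eq_abs, Real.norm_eq_abs, mul_one, one_pow,
      mul_one, sq_abs]
    rw [show (4 : ℕ) = 2 * 2 from rfl, pow_mul, sq_abs, Real.sq_sqrt (hl i)]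

/-- Orthogonalization: a POVM whose elements are close to idempotent in normalized Frobenius norm
is close to a projective measurement. -/
lemma IsPOVM.exists_isProjMeas {m 𝒜 : Type*} [Fintype m] [DecidableEq m] [Fintype 𝒜]
    [DecidableEq 𝒜] {B : 𝒜 → Matrix m m ℂ} (hB : IsPOVM B) :
    ∃ Q : 𝒜 → Matrix m m ℂ, IsProjMeas Q ∧
      ∑ a, ∑ i, ∑ j, Complex.normSq ((B a - Q a) i j) ≤
        3 * (Fintype.card m - ∑ a, ∑ i, ∑ j, Complex.normSq (B a i j)) := by
  choose w hw hw4 using fun a => exists_orthogonal_decomposition (hB.1 a)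
  obtain ⟨S, e, he⟩ := exists_orthonormalBasis_of_parseval (fun p : 𝒜 × m => w p.1 p.2)
    (fun h => by
      rw [Fintype.sum_prod_type]
      simp_rw [← hw]
      rw [← Complex.re_sum, ← dotProduct_sum, ← Matrix.sum_mulVec, hB.2, Matrix.one_mulVec,
        dotProduct_comm, ← EuclideanSpace.inner_eq_star_dotProduct, inner_self_eq_norm_sq_to_K]
      norm_cast)
  rw [Fintype.sum_prod_type] at he
  simp only [hw4, finrank_euclideanSpace] at he
  let M : Matrix m S ℂ := Matrix.of fun i k => (e k).ofLp i
  have hM : Mᴴ * M = 1 := by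
    ext k l
    have := orthonormal_iff_ite.1 e.orthonormal k l
    rw [EuclideanSpace.inner_eq_star_dotProduct, dotProduct_comm] at this
    simpa [Matrix.mul_apply, Matrix.one_apply, dotProduct, M] using this
  have hcard : Fintype.card S = Fintype.card m := by
    rw [← Module.finrank_eq_card_basis e.toBasis, finrank_euclideanSpace]
  have hM' : M * Mᴴ = 1 := (Matrix.mul_eq_one_comm_of_card_eq _ _ _ hcard).1 hM
  let D (a : 𝒜) : Matrix S S ℂ := Matrix.diagonal fun k => if k.1.1 = a then 1 else 0
  let Q (a : 𝒜) : Matrix m m ℂ := M * D a * Mᴴ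
  have hQH (a) : (Q a)ᴴ = Q a := by
    have : (D a)ᴴ = D a := by
      simp only [D, Matrix.diagonal_conjTranspose]
      congr 1; ext k; by_cases h : k.1.1 = a <;> simp [h]
    simp [Q, Matrix.conjTranspose_mul, this, Matrix.mul_assoc]
  have hQQ (a) : Q a * Q a = Q a := by
    have : D a * D a = D a := by simp [D, Matrix.diagonal_mul_diagonal]
    calc Q a * Q a = M * D a * (Mᴴ * M) * D a * Mᴴ := by simp only [Q, Matrix.mul_assoc]
      _ = M * (D a * D a) * Mᴴ := by rw [hM, Matrix.mul_one, Matrix.mul_assoc M]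
      _ = Q a := by rw [this]
  have hQ1 : ∑ a, Q a = 1 := by
    have : ∑ a, D a = 1 := by
      ext k l
      rw [Matrix.sum_apply]
      by_cases h : k = l <;> simp [D, Matrix.one_apply, h]
    simp only [Q]
    rw [← Matrix.sum_mul, ← Matrix.mul_sum, this, Matrix.mul_one, hM']
  refine ⟨Q, ⟨fun a => ⟨hQH a, hQQ a⟩, hQ1⟩, ?_⟩
  have hcross : ∑ k : S, ‖inner ℂ (w k.1.1 k.1.2) (e k)‖ ^ 2 ≤ ∑ a, (B a * Q a).trace.re := by
    have h1 (a) : (B a * Q a).trace.re =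
        ∑ k : S, if k.1.1 = a then (star (e k).ofLp ⬝ᵥ B k.1.1 *ᵥ (e k).ofLp).re else 0 := by
      have : (B a * Q a).trace = ((Mᴴ * (B a * M)) * D a).trace := by
        rw [show B a * Q a = (B a * M * D a) * Mᴴ by simp only [Q, Matrix.mul_assoc],
          Matrix.trace_mul_comm, ← Matrix.mul_assoc]
      rw [this, Matrix.trace, Complex.re_sum]
      refine Finset.sum_congr rfl fun k _ => ?_
      by_cases h : k.1.1 = a
      · subst h
        simp only [D, Matrix.diag_apply, Matrix.mul_diagonal, if_true, mul_one]
        rfl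
      · simp [D, h]
    simp_rw [h1]
    rw [Finset.sum_comm]
    refine Finset.sum_le_sum fun k _ => ?_
    rw [Finset.sum_ite_eq, if_pos (Finset.mem_univ _), hw]
    exact Finset.single_le_sum (f := fun i => ‖inner ℂ (w k.1.1 i) (e k)‖ ^ 2)
      (fun _ _ => sq_nonneg _) (Finset.mem_univ _)
  have hQtr : ∑ a, (Q a).trace.re = Fintype.card m := by
    rw [← Complex.re_sum, ← Matrix.trace_sum, hQ1, Matrix.trace_one]; simp
  have hexp (a) : ∑ i, ∑ j, Complex.normSq ((B a - Q a) i j) =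
      ∑ i, ∑ j, Complex.normSq (B a i j) + (Q a).trace.re - 2 * (B a * Q a).trace.re := by
    rw [sum_normSq_eq_trace, sum_normSq_eq_trace, Matrix.conjTranspose_sub, hQH,
      (hB.1 a).isHermitian.eq, Matrix.sub_mul, Matrix.mul_sub, Matrix.mul_sub, hQQ]
    simp only [Matrix.trace_sub, Complex.sub_re, Matrix.trace_mul_comm (Q a) (B a)]
    ring
  simp_rw [hexp]
  rw [Finset.sum_sub_distrib, Finset.sum_add_distrib, hQtr, ← Finset.mul_sum]
  linarith

/-- A POVM compressed to a coordinate subspace is close to a projective measurement on it, up to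
its deviation from idempotence and its off-diagonal part. -/
lemma IsPOVM.exists_isProjMeasOn {m 𝒜 : Type*} [Fintype m] [DecidableEq m] [Fintype 𝒜]
    [DecidableEq 𝒜] {A : 𝒜 → Matrix m m ℂ} (hA : IsPOVM A) (S : Finset m) :
    ∃ Q : 𝒜 → Matrix m m ℂ, IsProjMeasOn (Matrix.diagonal fun i => if i ∈ S then 1 else 0) Q ∧
      ∑ a, ∑ j ∈ S, ∑ i, Complex.normSq ((A a - Q a) i j) ≤
        3 * (S.card - ∑ a, ∑ j ∈ S, ∑ i, Complex.normSq (A a i j)) +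
          4 * ∑ a, ∑ j ∈ S, ∑ i ∈ Sᶜ, Complex.normSq (A a i j) := by
  have hB : IsPOVM fun a => (A a).submatrix ((↑) : S → m) (↑) := by
    refine ⟨fun a => (hA.1 a).submatrix _, ?_⟩
    ext k l
    have := congrFun (congrFun hA.2 k) l
    rw [Matrix.sum_apply] at this ⊢
    simpa [Matrix.one_apply] using this
  obtain ⟨Q, ⟨hQ, hQ1⟩, hle⟩ := hB.exists_isProjMeas
  let E : Matrix m S ℂ := (1 : Matrix m m ℂ).submatrix id (↑)
  have hE : Eᴴ * E = 1 := by
    ext k l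
    simp [E, Matrix.mul_apply, Matrix.one_apply]
  have hE' : E * Eᴴ = Matrix.diagonal fun i => if i ∈ S then (1 : ℂ) else 0 := by
    ext i j
    simp only [E, Matrix.mul_apply, Matrix.conjTranspose_apply, Matrix.submatrix_apply, id,
      Matrix.one_apply, Matrix.diagonal_apply, apply_ite star, star_one, star_zero, mul_ite,
      mul_one, mul_zero, ← ite_and]
    rw [Finset.sum_coe_sort S (fun k => if j = k ∧ i = k then (1 : ℂ) else 0)]
    by_cases hij : i = j
    · subst hij; simp
    · simp only [hij, false_and, if_false]
      exact Finset.sum_eq_zero fun k _ => if_neg fun h => hij (h.2.trans h.1.symm)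
  have hmul (X Y : Matrix S S ℂ) : E * X * Eᴴ * (E * Y * Eᴴ) = E * (X * Y) * Eᴴ := by
    calc _ = E * X * (Eᴴ * E) * Y * Eᴴ := by simp only [Matrix.mul_assoc]
      _ = _ := by rw [hE, Matrix.mul_one, Matrix.mul_assoc E]
  have hP : E * Eᴴ = E * (1 : Matrix S S ℂ) * Eᴴ := by rw [Matrix.mul_one]
  have hin (X : Matrix S S ℂ) (k l : S) : (E * X * Eᴴ) k l = X k l := by
    simp [E, Matrix.mul_apply, Matrix.one_apply]
  have hout (X : Matrix S S ℂ) (i : m) (hi : i ∉ S) (j : m) : (E * X * Eᴴ) i j = 0 := by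
    have h (k : S) : i ≠ k := fun h => hi (h ▸ k.2)
    simp [E, Matrix.mul_apply, Matrix.one_apply, h]
  refine ⟨fun a => E * Q a * Eᴴ, ⟨fun a => ⟨?_, ?_, ?_, ?_⟩, ?_⟩, ?_⟩
  · simp [Matrix.conjTranspose_mul, (hQ a).1, Matrix.mul_assoc]
  · rw [hmul, (hQ a).2]
  · rw [← hE', hP, hmul, Matrix.one_mul]
  · rw [← hE', hP, hmul, Matrix.mul_one]
  · rw [← Matrix.sum_mul, ← Matrix.mul_sum, hQ1, Matrix.mul_one, hE']
  · have hL (a) : ∑ j ∈ S, ∑ i, Complex.normSq ((A a - E * Q a * Eᴴ) i j) =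
        ∑ i, ∑ j, Complex.normSq (((A a).submatrix ((↑) : S → m) ((↑) : S → m) - Q a) i j) +
          ∑ j ∈ S, ∑ i ∈ Sᶜ, Complex.normSq (A a i j) := by
      simp_rw [← Finset.sum_add_sum_compl S]
      rw [Finset.sum_add_distrib]
      congr 1
      · rw [Finset.sum_comm (s := (Finset.univ : Finset S)), ← Finset.sum_coe_sort S]
        refine Finset.sum_congr rfl fun j _ => ?_
        rw [← Finset.sum_coe_sort S]
        simp [hin]
      · refine Finset.sum_congr rfl fun j _ => Finset.sum_congr rfl fun i hi => ?_
        rw [Matrix.sub_apply, hout _ _ (Finset.mem_compl.1 hi), sub_zero]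
    have hR (a) : ∑ j ∈ S, ∑ i, Complex.normSq (A a i j) =
        ∑ i, ∑ j, Complex.normSq ((A a).submatrix ((↑) : S → m) ((↑) : S → m) i j) +
          ∑ j ∈ S, ∑ i ∈ Sᶜ, Complex.normSq (A a i j) := by
      simp_rw [← Finset.sum_add_sum_compl S]
      rw [Finset.sum_add_distrib, Finset.sum_comm (s := (Finset.univ : Finset S)),
        ← Finset.sum_coe_sort S]
      simp only [← Finset.sum_coe_sort S, Matrix.submatrix_apply]
    rw [Fintype.card_coe] at hle
    simp only [hL, hR, Finset.sum_add_distrib]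
    linarith

lemma trace_sq_mul_smul_diagonal {m : Type*} [Fintype m] [DecidableEq m] {X : Matrix m m ℂ}
    (hX : Xᴴ = X) (S : Finset m) {P : Matrix m m ℂ}
    (hP : P = Matrix.diagonal fun i => if i ∈ S then 1 else 0) :
    ((X * X * (P.trace⁻¹ • P)).trace).re * P.trace.re =
      ∑ j ∈ S, ∑ i, Complex.normSq (X i j) := by
  have htr : P.trace = ((S.card : ℝ) : ℂ) := by simp [hP]
  have h1 : (X * X * P).trace = ((∑ j ∈ S, ∑ i, Complex.normSq (X i j) : ℝ) : ℂ) := by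
    rw [hP]
    simp only [Matrix.trace, Matrix.diag_apply, Matrix.mul_diagonal, mul_ite, mul_one, mul_zero,
      Finset.sum_ite_mem, Finset.univ_inter, Complex.ofReal_sum]
    refine Finset.sum_congr rfl fun j _ => ?_
    rw [Matrix.mul_apply]
    refine Finset.sum_congr rfl fun i _ => ?_
    rw [Complex.normSq_eq_conj_mul_self]
    congr 1
    exact (congrFun (congrFun hX j) i).symm
  rw [Matrix.mul_smul, Matrix.trace_smul, h1, htr, smul_eq_mul, ← Complex.ofReal_inv,
    ← Complex.ofReal_mul, Complex.ofReal_re, Complex.ofReal_re]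
  rcases S.eq_empty_or_nonempty with rfl | hS
  · simp
  · have : (S.card : ℝ) ≠ 0 := by simpa using hS.ne_empty
    field_simp

lemma sum_normSq_col_le {m : Type*} [Fintype m] [DecidableEq m] {A : Matrix m m ℂ}
    (hA : A.PosSemidef) (hA1 : (1 - A).PosSemidef) (j : m) :
    ∑ i, Complex.normSq (A i j) ≤ (A j j).re := by
  have h : (A - A * A).PosSemidef := by
    have h1 := hA.mul_mul_conjTranspose_same (1 - A)
    have h2 := hA1.mul_mul_conjTranspose_same A
    rw [hA1.isHermitian.eq] at h1
    rw [hA.isHermitian.eq] at h2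
    convert h1.add h2 using 1
    noncomm_ring
  have hd := (Complex.le_def.1 (h.diag_nonneg (i := j))).1
  have hs : (A * A) j j = ((∑ i, Complex.normSq (A i j) : ℝ) : ℂ) := by
    rw [Matrix.mul_apply, Complex.ofReal_sum]
    refine Finset.sum_congr rfl fun i _ => ?_
    rw [Complex.normSq_eq_conj_mul_self]
    congr 1
    exact (congrFun (congrFun hA.isHermitian.eq j) i).symm
  rw [Matrix.sub_apply, hs, Complex.sub_re, Complex.ofReal_re, Complex.zero_re] at hd
  linarith

lemma IsPOVM.sum_normSq_col_le_one {m 𝒜 : Type*} [Fintype m] [DecidableEq m] [Fintype 𝒜]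
    {A : 𝒜 → Matrix m m ℂ} (hA : IsPOVM A) (j : m) :
    ∑ i, ∑ a, Complex.normSq (A a i j) ≤ 1 := by
  classical
  rw [Finset.sum_comm]
  have h1 (a) : (1 - A a).PosSemidef := by
    rw [← hA.2, ← Finset.add_sum_erase _ _ (Finset.mem_univ a), add_sub_cancel_left]
    exact Matrix.posSemidef_sum _ fun b _ => hA.1 b
  refine (Finset.sum_le_sum fun a _ => sum_normSq_col_le (hA.1 a) (h1 a) j).trans_eq ?_
  rw [← Complex.re_sum, ← Matrix.sum_apply, hA.2]
  simp

lemma ev_canonPsi {m : Type*} [Fintype m] [DecidableEq m] (lam : m → ℝ) (X Y : Matrix m m ℂ) :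
    ev (canonPsi lam) (X ⊗ₖ Yᵀ) =
      ∑ i, ∑ j, Real.sqrt (lam i) * Real.sqrt (lam j) * (X i j * Y j i).re := by
  have h (i j : m) : (Real.sqrt (lam i) : ℂ) * (X i j * Y j i * Real.sqrt (lam j)) =
      ((Real.sqrt (lam i) * Real.sqrt (lam j) : ℝ) : ℂ) * (X i j * Y j i) := by
    push_cast; ring
  simp only [ev, dotProduct, Matrix.mulVec, Fintype.sum_prod_type, canonPsi, Pi.star_apply,
    apply_ite star, star_zero, ite_mul, zero_mul, mul_ite, mul_zero, Finset.sum_ite_eq,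
    Finset.mem_univ, if_true, Matrix.kroneckerMap_apply, Matrix.transpose_apply, RCLike.star_def,
    Complex.conj_ofReal]
  simp only [Finset.mul_sum, h, Complex.re_sum, Complex.re_ofReal_mul]

/-- The synchronicity default of a symmetric strategy in terms of matrix entries. -/
lemma deltaSync_canonPsi {m 𝒳 𝒜 : Type*} [Fintype m] [DecidableEq m] [Fintype 𝒳] [Fintype 𝒜]
    [DecidableEq 𝒜] (ν : 𝒳 → ℝ) {lam : m → ℝ} (hlam : ∀ i, 0 ≤ lam i) (hlam1 : ∑ i, lam i = 1)
    {A : 𝒳 → 𝒜 → Matrix m m ℂ} (hA : ∀ x, IsPOVM (A x)) :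
    deltaSync ν (canonPsi lam) A (fun x a => (A x a)ᵀ) =
      ∑ x, ν x * (1 - ∑ i, ∑ j, Real.sqrt (lam i) * Real.sqrt (lam j) *
        ∑ a, Complex.normSq (A x a i j)) := by
  refine Finset.sum_congr rfl fun x _ => ?_
  congr 1
  have hsplit (f : 𝒜 → 𝒜 → ℝ) : ∑ a, ∑ b, (if a = b then 0 else f a b) =
      ∑ a, ∑ b, f a b - ∑ a, f a a := by
    rw [← Finset.sum_sub_distrib]
    refine Finset.sum_congr rfl fun a _ => ?_
    rw [← Finset.add_sum_erase _ _ (Finset.mem_univ a),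
      ← Finset.add_sum_erase _ (f a) (Finset.mem_univ a), if_pos rfl, zero_add,
      add_sub_cancel_left]
    exact Finset.sum_congr rfl fun b hb => if_neg (Finset.ne_of_mem_erase hb).symm
  have hpair (f : 𝒜 → m → m → ℝ) : ∑ a, ∑ i, ∑ j, Real.sqrt (lam i) * Real.sqrt (lam j) * f a i j =
      ∑ i, ∑ j, Real.sqrt (lam i) * Real.sqrt (lam j) * ∑ a, f a i j := by
    simp_rw [Finset.mul_sum]
    rw [Finset.sum_comm]
    exact Finset.sum_congr rfl fun i _ => Finset.sum_comm
  rw [hsplit]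
  simp only [ev_canonPsi, hpair]
  congr 1
  · have hone (i j : m) : ∑ a, ∑ b, (A x a i j * A x b j i).re = if i = j then 1 else 0 := by
      simp_rw [← Complex.re_sum, ← Finset.mul_sum, ← Finset.sum_mul, ← Matrix.sum_apply,
        (hA x).2]
      by_cases h : i = j
      · subst h; simp
      · simp [h]
    simp_rw [hone]
    simp [Real.mul_self_sqrt (hlam _), hlam1]
  · refine Finset.sum_congr rfl fun i _ => Finset.sum_congr rfl fun j _ => ?_
    congr 1
    refine Finset.sum_congr rfl fun a _ => ?_
    rw [← ((hA x).1 a).isHermitian.apply j i, RCLike.star_def, Complex.mul_conj,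
      Complex.ofReal_re]

lemma integrableOn_step (l : ℝ) :
    IntegrableOn (fun t : ℝ => if t ≤ l then (1 : ℝ) else 0) (Set.Ioi 0) := by
  have h : (fun t : ℝ => if t ≤ l then (1 : ℝ) else 0) =
      (Set.Iic l).indicator (fun _ => (1 : ℝ)) := by
    ext t; simp [Set.indicator_apply]
  rw [h, IntegrableOn, integrable_indicator_iff measurableSet_Iic, IntegrableOn,
    Measure.restrict_restrict measurableSet_Iic, Set.inter_comm, Set.Ioi_inter_Iic]
  exact integrableOn_const (by simp)

lemma setIntegral_step {l : ℝ} (hl : 0 ≤ l) :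
    ∫ t in Set.Ioi (0 : ℝ), (if t ≤ l then (1 : ℝ) else 0) = l := by
  have h : (fun t : ℝ => if t ≤ l then (1 : ℝ) else 0) =
      (Set.Iic l).indicator (fun _ => (1 : ℝ)) := by
    ext t; simp [Set.indicator_apply]
  rw [h, integral_indicator measurableSet_Iic, Measure.restrict_restrict measurableSet_Iic,
    Set.inter_comm, Set.Ioi_inter_Iic]
  simp [hl]

lemma diagonal_eq_sum_single {m R : Type*} [Fintype m] [DecidableEq m] [AddCommMonoid R]
    (d : m → R) : Matrix.diagonal d = ∑ i, Matrix.single i i (d i) := by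
  ext i j
  rw [Matrix.sum_apply, Matrix.diagonal_apply, Finset.sum_eq_single i]
  · simp [Matrix.single_apply]
  · intro k _ hk
    simp [hk]
  · simp

lemma setIntegral_Pdiag {m : Type*} [Fintype m] [DecidableEq m] {lam : m → ℝ}
    (hlam : ∀ i, 0 ≤ lam i) :
    ∫ t in Set.Ioi (0 : ℝ), Pdiag lam t = Matrix.diagonal fun i => (lam i : ℂ) := by
  have h (t : ℝ) : Pdiag lam t =
      ∑ i, (if t ≤ lam i then (1 : ℝ) else 0) • Matrix.single i i (1 : ℂ) := by
    rw [Pdiag, diagonal_eq_sum_single]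
    refine Finset.sum_congr rfl fun i _ => ?_
    by_cases ht : t ≤ lam i <;> simp [ht]
  simp_rw [h]
  rw [integral_finsetSum _ fun i _ => (integrableOn_step (lam i)).smul_const _,
    diagonal_eq_sum_single]
  refine Finset.sum_congr rfl fun i _ => ?_
  rw [integral_smul_const, setIntegral_step (hlam i)]
  simp [Matrix.smul_single]

lemma setIntegral_trace_Pdiag {m : Type*} [Fintype m] [DecidableEq m] {lam : m → ℝ}
    (hlam : ∀ i, 0 ≤ lam i) :
    ∫ t in Set.Ioi (0 : ℝ), (Pdiag lam t).trace.re = ∑ i, lam i := by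
  have h (t : ℝ) : (Pdiag lam t).trace.re = ∑ i, (if t ≤ lam i then (1 : ℝ) else 0) := by
    rw [Pdiag, Matrix.trace_diagonal, Complex.re_sum]
    refine Finset.sum_congr rfl fun i _ => ?_
    by_cases ht : t ≤ lam i <;> simp [ht]
  simp_rw [h]
  rw [integral_finsetSum _ fun i _ => integrableOn_step (lam i)]
  exact Finset.sum_congr rfl fun i _ => setIntegral_step (hlam i)

/-- Functions of the super-level sets of a finite family are integrable if they vanish at the
empty set. -/
lemma integrableOn_superlevel {m : Type*} [Fintype m] [DecidableEq m] (lam : m → ℝ)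
    (f : Finset m → ℝ) (hf : f ∅ = 0) :
    IntegrableOn (fun t : ℝ => f (Finset.univ.filter fun i => t ≤ lam i)) (Set.Ioi 0) := by
  let _ : MeasurableSpace (Finset m) := ⊤
  have hmeas : Measurable fun t : ℝ => f (Finset.univ.filter fun i => t ≤ lam i) := by
    refine (measurable_from_top (f := f)).comp (measurable_to_countable' fun S => ?_)
    have : (fun t : ℝ => Finset.univ.filter fun i => t ≤ lam i) ⁻¹' {S} =
        ⋂ i, {t | t ≤ lam i ↔ i ∈ S} := by
      ext t; simp [Finset.ext_iff]
    rw [this]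
    refine MeasurableSet.iInter fun i => ?_
    by_cases h : i ∈ S
    · simpa only [h, iff_true] using! measurableSet_Iic (a := lam i)
    · simpa only [h, iff_false, not_le] using! measurableSet_Ioi (a := lam i)
  refine Integrable.mono'
    (g := fun t => ∑ i, (∑ S, |f S|) * (if t ≤ lam i then (1 : ℝ) else 0))
    (integrable_finsetSum _ fun i _ => (integrableOn_step (lam i)).const_mul _)
    hmeas.aestronglyMeasurable (Filter.Eventually.of_forall fun t => ?_)
  have hnn : 0 ≤ ∑ S, |f S| := Finset.sum_nonneg fun _ _ => abs_nonneg _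
  have hterm (i : m) : 0 ≤ (∑ S, |f S|) * (if t ≤ lam i then (1 : ℝ) else 0) :=
    mul_nonneg hnn (by split_ifs <;> norm_num)
  rcases (Finset.univ.filter fun i => t ≤ lam i).eq_empty_or_nonempty with h | ⟨i, hi⟩
  · simpa [h, hf] using Finset.sum_nonneg fun i _ => hterm i
  · refine le_trans ?_ (Finset.single_le_sum (fun i _ => hterm i) (Finset.mem_univ i))
    rw [if_pos (Finset.mem_filter.1 hi).2, mul_one, Real.norm_eq_abs]
    exact Finset.single_le_sum (f := fun S => |f S|) (fun _ _ => abs_nonneg _)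
      (Finset.mem_univ _)

/-- Layer-cake estimate: bounding a super-level functional by its commutator with the levels. -/
lemma setIntegral_superlevel_le {m : Type*} [Fintype m] [DecidableEq m] {lam : m → ℝ}
    (hlam : ∀ i, 0 ≤ lam i) (N : m → m → ℝ) (f : Finset m → ℝ) (hf : f ∅ = 0)
    (hfN : ∀ S, f S ≤ 3 * (S.card - ∑ j ∈ S, ∑ i, N i j) +
      4 * ∑ j ∈ S, ∑ i ∈ Sᶜ, N i j) :
    ∫ t in Set.Ioi (0 : ℝ), f (Finset.univ.filter fun i => t ≤ lam i) ≤
      3 * ∑ j, lam j * (1 - ∑ i, N i j) +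
        4 * ∑ j, ∑ i, (lam j - min (lam i) (lam j)) * N i j := by
  let χ (l t : ℝ) : ℝ := if t ≤ l then 1 else 0
  have hχ (l) : IntegrableOn (χ l) (Set.Ioi 0) := integrableOn_step l
  let g (t : ℝ) : ℝ := 3 * ∑ j, χ (lam j) t * (1 - ∑ i, N i j) +
        4 * ∑ j, ∑ i, (χ (lam j) t - χ (min (lam i) (lam j)) t) * N i j
  have i1 (j) : IntegrableOn (fun t => χ (lam j) t * (1 - ∑ i, N i j)) (Set.Ioi 0) :=
    (hχ _).mul_const _
  have i2 (j i) : IntegrableOn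
      (fun t => (χ (lam j) t - χ (min (lam i) (lam j)) t) * N i j) (Set.Ioi 0) :=
    ((hχ _).sub (hχ _)).mul_const _
  have i3 : IntegrableOn (fun t => 3 * ∑ j, χ (lam j) t * (1 - ∑ i, N i j)) (Set.Ioi 0) :=
    (integrable_finsetSum _ fun j _ => i1 j).const_mul _
  have i4 (j) : IntegrableOn
      (fun t => ∑ i, (χ (lam j) t - χ (min (lam i) (lam j)) t) * N i j) (Set.Ioi 0) :=
    integrable_finsetSum _ fun i _ => i2 j i
  have i5 : IntegrableOn
      (fun t => 4 * ∑ j, ∑ i, (χ (lam j) t - χ (min (lam i) (lam j)) t) * N i j) (Set.Ioi 0) :=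
    (integrable_finsetSum _ fun j _ => i4 j).const_mul _
  have hg : ∫ t in Set.Ioi (0 : ℝ), g t = 3 * ∑ j, lam j * (1 - ∑ i, N i j) +
        4 * ∑ j, ∑ i, (lam j - min (lam i) (lam j)) * N i j := by
    simp only [g]
    rw [integral_add i3 i5, integral_const_mul, integral_const_mul,
      integral_finsetSum _ fun j _ => i1 j, integral_finsetSum _ fun j _ => i4 j]
    congr 2
    · refine Finset.sum_congr rfl fun j _ => ?_
      rw [integral_mul_const, setIntegral_step (hlam j)]
    · refine Finset.sum_congr rfl fun j _ => ?_
      rw [integral_finsetSum _ fun i _ => i2 j i]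
      refine Finset.sum_congr rfl fun i _ => ?_
      rw [integral_mul_const, integral_sub (hχ _) (hχ _), setIntegral_step (hlam j),
        setIntegral_step (le_min (hlam i) (hlam j))]
  rw [← hg]
  refine integral_mono (integrableOn_superlevel lam f hf) (i3.add i5) fun t => ?_
  refine (hfN _).trans_eq ?_
  set S := Finset.univ.filter fun i => t ≤ lam i with hS
  have hχS (j) : χ (lam j) t = if j ∈ S then 1 else 0 := by simp [χ, hS]
  have hχmin (i j) : χ (min (lam i) (lam j)) t = χ (lam i) t * χ (lam j) t := by
    simp only [χ, le_min_iff]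
    by_cases h : t ≤ lam i <;> by_cases h' : t ≤ lam j <;> simp [h, h']
  have e1 : (S.card : ℝ) - ∑ j ∈ S, ∑ i, N i j = ∑ j, χ (lam j) t * (1 - ∑ i, N i j) := by
    simp [hχS, Finset.sum_sub_distrib]
  have e2 : ∑ j ∈ S, ∑ i ∈ Sᶜ, N i j =
      ∑ j, ∑ i, (χ (lam j) t - χ (min (lam i) (lam j)) t) * N i j := by
    rw [← Finset.sum_subset (Finset.subset_univ S)]
    · refine Finset.sum_congr rfl fun j hj => ?_
      rw [← Finset.sum_subset (Finset.subset_univ Sᶜ)]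
      · refine Finset.sum_congr rfl fun i hi => ?_
        simp [hχmin, hχS, hj, Finset.mem_compl.1 hi]
      · intro i _ hi
        have : i ∈ S := by simpa using hi
        simp [hχmin, hχS, hj, this]
    · intro j _ hj
      simp [hχmin, hχS, hj]
  simp only [e1, e2, g]

lemma sum_mul_le_one {m : Type*} [Fintype m] {lam : m → ℝ} (hlam : ∀ i, 0 ≤ lam i)
    (hlam1 : ∑ i, lam i = 1) {N : m → m → ℝ} (hN1 : ∀ j, ∑ i, N i j ≤ 1) :
    ∑ j, ∑ i, lam j * N i j ≤ 1 := by
  rw [← hlam1]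
  refine Finset.sum_le_sum fun j _ => ?_
  rw [← Finset.mul_sum]
  nlinarith [hlam j, hN1 j]

lemma sum_sqrt_mul_sqrt_mul_le {m : Type*} [Fintype m] {lam : m → ℝ} (hlam : ∀ i, 0 ≤ lam i)
    {N : m → m → ℝ} (hN : ∀ i j, 0 ≤ N i j) (hNsymm : ∀ i j, N i j = N j i) :
    ∑ i, ∑ j, Real.sqrt (lam i) * Real.sqrt (lam j) * N i j ≤ ∑ j, ∑ i, lam j * N i j := by
  have hcomm : ∑ i, ∑ j, lam j * N i j = ∑ j, ∑ i, lam j * N i j := Finset.sum_comm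
  have hself : ∑ i, ∑ j, lam i * N i j = ∑ j, ∑ i, lam j * N i j := by simp_rw [hNsymm]
  have h : ∑ i, ∑ j, 2 * (Real.sqrt (lam i) * Real.sqrt (lam j) * N i j) ≤
      ∑ i, ∑ j, (lam i * N i j + lam j * N i j) := by
    refine Finset.sum_le_sum fun i _ => Finset.sum_le_sum fun j _ => ?_
    have := mul_nonneg (sq_nonneg (Real.sqrt (lam i) - Real.sqrt (lam j))) (hN i j)
    rw [sub_sq, Real.sq_sqrt (hlam i), Real.sq_sqrt (hlam j)] at this
    linarith
  simp only [Finset.sum_add_distrib, hself, hcomm] at h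
  simp only [← Finset.mul_sum] at h ⊢
  linarith

/-- Connes-type estimate: `|λ_i - λ_j|` is controlled by `(√λ_i - √λ_j)²`. -/
lemma sum_sub_min_mul_le {m : Type*} [Fintype m] {lam : m → ℝ} (hlam : ∀ i, 0 ≤ lam i)
    (hlam1 : ∑ i, lam i = 1) {N : m → m → ℝ} (hN : ∀ i j, 0 ≤ N i j)
    (hNsymm : ∀ i j, N i j = N j i) (hN1 : ∀ j, ∑ i, N i j ≤ 1) {s : ℝ} (hs : 0 < s) :
    3 * ∑ j, lam j * (1 - ∑ i, N i j) + 4 * ∑ j, ∑ i, (lam j - min (lam i) (lam j)) * N i j ≤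
      (3 + 4 / s) * (1 - ∑ i, ∑ j, Real.sqrt (lam i) * Real.sqrt (lam j) * N i j) + 8 * s := by
  set G := ∑ i, ∑ j, Real.sqrt (lam i) * Real.sqrt (lam j) * N i j with hG
  set K := ∑ j, ∑ i, lam j * N i j with hK
  have hK' : ∑ j, ∑ i, lam i * N i j = K := by
    rw [hK, Finset.sum_comm]
    simp_rw [hNsymm]
  have hG' : ∑ j, ∑ i, Real.sqrt (lam i) * Real.sqrt (lam j) * N i j = G := Finset.sum_comm
  have hK1 : K ≤ 1 := sum_mul_le_one hlam hlam1 hN1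
  have hKG : G ≤ K := sum_sqrt_mul_sqrt_mul_le hlam hN hNsymm
  have e1 : ∑ j, lam j * (1 - ∑ i, N i j) = 1 - K := by
    simp_rw [mul_sub, mul_one, Finset.sum_sub_distrib, hlam1, Finset.mul_sum]; rfl
  have hpt (i j) : lam j - min (lam i) (lam j) ≤ s * (lam i + lam j) +
      (lam i + lam j - 2 * (Real.sqrt (lam i) * Real.sqrt (lam j))) / (2 * s) := by
    have hi := Real.sq_sqrt (hlam i)
    have hj := Real.sq_sqrt (hlam j)
    have pi := Real.sqrt_nonneg (lam i)
    have pj := Real.sqrt_nonneg (lam j)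
    generalize Real.sqrt (lam i) = p at *
    generalize Real.sqrt (lam j) = q at *
    rw [← hi, ← hj]
    have hsum : p ^ 2 + q ^ 2 - 2 * (p * q) = (q - p) ^ 2 := by ring
    rw [hsum]
    have hnn : 0 ≤ s * (p ^ 2 + q ^ 2) + (q - p) ^ 2 / (2 * s) := by positivity
    rcases le_total (p ^ 2) (q ^ 2) with h | h
    · rw [min_eq_left h, ← sub_le_iff_le_add', le_div_iff₀ (by positivity)]
      nlinarith [sq_nonneg (q - p - s * (p + q)), sq_nonneg (s * (p - q))]
    · rw [min_eq_right h, sub_self]; exact hnn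
  have e2 : ∑ j, ∑ i, (lam j - min (lam i) (lam j)) * N i j ≤ s * (K + K) + (K - G) / s := by
    calc _ ≤ ∑ j, ∑ i, (s * (lam i * N i j + lam j * N i j) +
          (lam i * N i j + lam j * N i j -
            2 * (Real.sqrt (lam i) * Real.sqrt (lam j) * N i j)) / (2 * s)) := by
          refine Finset.sum_le_sum fun j _ => Finset.sum_le_sum fun i _ => ?_
          refine (mul_le_mul_of_nonneg_right (hpt i j) (hN i j)).trans_eq ?_
          ring
      _ = s * (K + K) + (K + K - 2 * G) / (2 * s) := by
          simp_rw [Finset.sum_add_distrib, ← Finset.sum_div, ← Finset.mul_sum,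
            Finset.sum_sub_distrib, Finset.sum_add_distrib, ← Finset.mul_sum]
          rw [hK', hG', ← Finset.sum_add_distrib]
          simp only [Finset.mul_sum, Finset.sum_add_distrib, ← hK]
      _ = _ := by field_simp; ring
  have e3 : (K - G) / s ≤ (1 - G) / s := by gcongr
  have e4 : s * (K + K) ≤ 2 * s := by nlinarith
  rw [e1]
  have e5 : (3 + 4 / s) * (1 - G) = 3 * (1 - G) + 4 * ((1 - G) / s) := by ring
  rw [e5]
  linarith

/-- Optimization over the free parameter. -/
lemma le_sqrt_of_forall_pos {T δ : ℝ} (h0 : 0 ≤ δ) (h1 : δ ≤ 1)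
    (h : ∀ s > 0, T ≤ (3 + 4 / s) * δ + 8 * s) : T ≤ 15 * δ ^ (1 / 2 : ℝ) := by
  rw [← Real.sqrt_eq_rpow]
  rcases h0.eq_or_lt with rfl | hpos
  · rw [Real.sqrt_zero, mul_zero]
    refine le_of_forall_pos_le_add fun ε hε => ?_
    have := h (ε / 8) (by positivity)
    linarith
  · have hr := Real.sqrt_pos.2 hpos
    have := h _ hr
    have hsq := Real.sq_sqrt h0
    have hle : Real.sqrt δ ≤ 1 := Real.sqrt_le_one.2 h1
    generalize Real.sqrt δ = r at *
    subst hsq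
    have e : (3 + 4 / r) * r ^ 2 = 3 * r ^ 2 + 4 * r := by field_simp
    nlinarith

/-- the main theorem (Theorem `main`): an almost synchronous symmetric
strategy decomposes, up to error `C δ^c`, as a convex combination (over `λ`, with
probability measure `dμ(λ) = Tr(P_λ) dλ`) of projective maximally entangled strategies
supported on the spectral subspaces `H_λ` of the reduced density `ρ = diag(lam)`. -/
theorem stmt8 :
    ∃ c C : ℝ, 0 < c ∧ 0 < C ∧
    ∀ (n : ℕ) (𝒳 𝒜 : Type) [Fintype 𝒳] [Fintype 𝒜] [DecidableEq 𝒜]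
      (ν : 𝒳 → ℝ) (_hν : IsDist ν)
      (lam : Fin n → ℝ) (_hlam : ∀ i, 0 ≤ lam i) (_hlam1 : ∑ i, lam i = 1)
      (A : 𝒳 → 𝒜 → Matrix (Fin n) (Fin n) ℂ) (_hA : ∀ x, IsPOVM (A x))
      (δ : ℝ) (_hδ : δ = deltaSync ν (canonPsi lam) A (fun x a => (A x a)ᵀ)),
      ((∫ t in Set.Ioi (0:ℝ), Pdiag lam t) = Matrix.diagonal (fun i => (lam i : ℂ)))
      ∧ ((∫ t in Set.Ioi (0:ℝ), ((Pdiag lam t).trace.re)) = 1)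
      ∧ ∃ Al : ℝ → 𝒳 → 𝒜 → Matrix (Fin n) (Fin n) ℂ,
          (∀ t, 0 < t → ∀ x, IsProjMeasOn (Pdiag lam t) (Al t x)) ∧
          ∑ x, ν x * ∑ a,
              (∫ t in Set.Ioi (0:ℝ),
                ((((A x a - Al t x a) * (A x a - Al t x a)) *
                    (((Pdiag lam t).trace)⁻¹ • Pdiag lam t)).trace).re *
                  (Pdiag lam t).trace.re)
            ≤ C * δ ^ c := by
  refine ⟨1 / 2, 15, by norm_num, by norm_num, ?_⟩
  intro n 𝒳 𝒜 _ _ _ ν hν lam hlam hlam1 A hA δ hδ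
  refine ⟨setIntegral_Pdiag hlam, (setIntegral_trace_Pdiag hlam).trans hlam1, ?_⟩
  choose R hR hRle using fun x S => (hA x).exists_isProjMeasOn S
  have hP (t : ℝ) : Pdiag lam t = Matrix.diagonal fun i =>
      if i ∈ Finset.univ.filter fun i => t ≤ lam i then 1 else 0 := by
    simp [Pdiag]
  refine ⟨fun t x => R x (Finset.univ.filter fun i => t ≤ lam i), fun t _ x => ?_, ?_⟩
  · rw [hP]
    exact hR x _
  let f (x : 𝒳) (a : 𝒜) (S : Finset (Fin n)) : ℝ :=
    ∑ j ∈ S, ∑ i, Complex.normSq ((A x a - R x S a) i j)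
  have hf (x a) (t : ℝ) := trace_sq_mul_smul_diagonal
    (X := A x a - R x (Finset.univ.filter fun i => t ≤ lam i) a)
    (by rw [Matrix.conjTranspose_sub, ((hA x).1 a).isHermitian.eq, ((hR x _).1 a).1]) _ (hP t)
  simp_rw [hf]
  let N (x : 𝒳) (i j : Fin n) : ℝ := ∑ a, Complex.normSq (A x a i j)
  let G (x : 𝒳) : ℝ := ∑ i, ∑ j, Real.sqrt (lam i) * Real.sqrt (lam j) * N x i j
  have hN (x i j) : 0 ≤ N x i j := Finset.sum_nonneg fun _ _ => Complex.normSq_nonneg _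
  have hNsymm (x i j) : N x i j = N x j i := by
    refine Finset.sum_congr rfl fun a _ => ?_
    rw [← ((hA x).1 a).isHermitian.apply i j, RCLike.star_def, Complex.normSq_conj]
  have hbound (x) {s : ℝ} (hs : 0 < s) :
      ∑ a, ∫ t in Set.Ioi (0 : ℝ), f x a (Finset.univ.filter fun i => t ≤ lam i) ≤
        (3 + 4 / s) * (1 - G x) + 8 * s := by
    rw [← integral_finsetSum _ fun a _ => integrableOn_superlevel lam (f x a) rfl]
    refine (setIntegral_superlevel_le hlam (N x) (fun S => ∑ a, f x a S) (by simp [f])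
      fun S => ?_).trans
      (sum_sub_min_mul_le hlam hlam1 (hN x) (hNsymm x) (hA x).sum_normSq_col_le_one hs)
    have hsum (U : Finset (Fin n)) : ∑ j ∈ S, ∑ i ∈ U, N x i j =
        ∑ a, ∑ j ∈ S, ∑ i ∈ U, Complex.normSq (A x a i j) := by
      rw [Finset.sum_comm (s := Finset.univ (α := 𝒜))]
      exact Finset.sum_congr rfl fun j _ => Finset.sum_comm
    rw [hsum, hsum]
    exact hRle x S
  have hδG : δ = ∑ x, ν x * (1 - G x) := hδ.trans (deltaSync_canonPsi ν hlam hlam1 hA)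
  have hG0 (x) : 0 ≤ G x := Finset.sum_nonneg fun i _ => Finset.sum_nonneg fun j _ =>
    mul_nonneg (by positivity) (hN x i j)
  have hG1 (x) : G x ≤ 1 := (sum_sqrt_mul_sqrt_mul_le hlam (hN x) (hNsymm x)).trans
    (sum_mul_le_one hlam hlam1 (hA x).sum_normSq_col_le_one)
  have hδ1 : δ ≤ 1 := hδG.trans_le <| (Finset.sum_le_sum fun x _ =>
    mul_le_of_le_one_right (hν.1 x) (by linarith [hG0 x])).trans_eq hν.2
  have hδ0 : 0 ≤ δ := by
    rw [hδG]
    exact Finset.sum_nonneg fun x _ => mul_nonneg (hν.1 x) (by linarith [hG1 x])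
  refine le_sqrt_of_forall_pos hδ0 hδ1 fun s hs => ?_
  refine (Finset.sum_le_sum fun x _ =>
    mul_le_mul_of_nonneg_left (hbound x hs) (hν.1 x)).trans_eq ?_
  rw [hδG, Finset.mul_sum]
  simp_rw [mul_add, Finset.sum_add_distrib, ← Finset.sum_mul, hν.2, one_mul]
  congr 1
  exact Finset.sum_congr rfl fun x _ => by ring

end AlmostSync
end
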